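/- arXiv:2305.03818 — 2 statements merged into one kernel-verified Lean document; each statement's English description precedes it below -/
import Mathlib

section
/- Let q ≥ 0 and 1 ≤ t ≤ 2^q be integers, let m = 2^{q+1} − t and d = 7·2^q − 2t. Then for any m masses μ_1, …, μ_m on ℝ^d there exist four hyperplanes H_1, H_2, H_3, H_4 in ℝ^d such that any 3 of the four hyperplanes equipartition each μ_i; that is, for every choice of 1 ≤ i_1 < i_2 < i_3 ≤ 4 and every mass μ_r, each of the eight regions H_{i_1}^± ∩ H_{i_2}^± ∩ H_{i_3}^± has μ_r-measure μ_r(ℝ^d)/8. -/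
open MeasureTheory RealInnerProductSpace

noncomputable section

/-- The closed half-space determined by the hyperplane `{x | ⟪a, x⟫ = b}`:
`true` corresponds to `H⁺ = {x | ⟪a, x⟫ ≥ b}`, `false` to `H⁻ = {x | ⟪a, x⟫ ≤ b}`. -/
def halfSpace {d : ℕ} (a : EuclideanSpace ℝ (Fin d)) (b : ℝ) (ε : Bool) :
    Set (EuclideanSpace ℝ (Fin d)) :=
  if ε then {x | b ≤ ⟪a, x⟫} else {x | ⟪a, x⟫ ≤ b}

/-- The region `⋂ i ∈ s, H i ^ (ε i)` determined by the hyperplanes indexed by `s`. -/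
def region {d k : ℕ} (a : Fin k → EuclideanSpace ℝ (Fin d)) (b : Fin k → ℝ)
    (s : Finset (Fin k)) (ε : Fin k → Bool) : Set (EuclideanSpace ℝ (Fin d)) :=
  ⋂ i ∈ s, halfSpace (a i) (b i) (ε i)

section part_PA
open MvPolynomial Module

set_option linter.unusedSectionVars false
set_option linter.style.haveILetI false
namespace BU

variable {κ : Type} [Fintype κ] [DecidableEq κ] {d : ℕ}

/-- multi-degree weights: the variable `(j, l)` has degree `1` in group `j`. -/
def wt (κ : Type) [DecidableEq κ] (d : ℕ) : κ × Fin (d + 1) → (κ → ℕ) :=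
  fun s => Pi.single s.1 1

abbrev Rg (κ : Type) (d : ℕ) := MvPolynomial (κ × Fin (d + 1)) ℝ

/-- the multigraded piece -/
abbrev Sg (κ : Type) [DecidableEq κ] (d : ℕ) (b : κ → ℕ) : Submodule ℝ (Rg κ d) :=
  weightedHomogeneousSubmodule ℝ (wt κ d) b

lemma weight_apply (m : κ × Fin (d + 1) →₀ ℕ) (j : κ) :
    Finsupp.weight (wt κ d) m j = ∑ l, m (j, l) := by
  rw [Finsupp.weight_apply, Finsupp.sum_fintype _ _ (by simp)]
  simp only [Finset.sum_apply, Pi.smul_apply, smul_eq_mul, wt]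
  rw [Fintype.sum_prod_type]
  simp [Pi.single_apply]

instance finS (b : κ → ℕ) : Module.Finite ℝ (Sg κ d b) := by
  have h : Sg κ d b ≤ restrictTotalDegree (κ × Fin (d + 1)) ℝ (∑ j, b j) := by
    intro p hp
    rw [mem_restrictTotalDegree]
    rw [MvPolynomial.totalDegree, Finset.sup_le_iff]
    intro m hm
    have := hp (mem_support_iff.1 hm)
    rw [← this, Finsupp.sum_fintype _ _ (by simp)]
    simp only [weight_apply]
    rw [Fintype.sum_prod_type]
  exact Submodule.finiteDimensional_of_le h

open scoped Classical in
lemma comp_mul {r g : Rg κ d} {δ : κ → ℕ} (hg : IsWeightedHomogeneous (wt κ d) g δ) (b : κ → ℕ) :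
    weightedHomogeneousComponent (wt κ d) b (r * g) =
      if δ ≤ b then weightedHomogeneousComponent (wt κ d) (b - δ) r * g else 0 := by
  induction r using MvPolynomial.induction_on' with
  | monomial u a =>
    have h1 : IsWeightedHomogeneous (wt κ d) (monomial u a : Rg κ d) (Finsupp.weight (wt κ d) u) :=
      isWeightedHomogeneous_monomial _ _ _ rfl
    have h2 := h1.mul hg
    rw [weightedHomogeneousComponent_of_mem h2, weightedHomogeneousComponent_of_mem h1]
    split_ifs with h3 h4 h5 h4 h5 <;> simp_all
    exfalso
    apply h3
    rw [← h5]; exact (tsub_add_cancel_of_le h4).symm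
  | add p q hp hq =>
    rw [add_mul, map_add, hp, hq]
    split_ifs
    · rw [map_add, add_mul]
    · simp

def IsHom (J : Ideal (Rg κ d)) : Prop :=
  ∀ f ∈ J, ∀ b, weightedHomogeneousComponent (wt κ d) b f ∈ J

lemma isHom_span {A : Set (Rg κ d)} (hA : ∀ g ∈ A, ∃ δ, IsWeightedHomogeneous (wt κ d) g δ) :
    IsHom (Ideal.span A) := by
  intro f hf
  induction hf using Submodule.span_induction with
  | zero => simp
  | add x y _ _ hx hy => intro b; rw [map_add]; exact Ideal.add_mem _ (hx b) (hy b)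
  | mem x hx =>
    intro b
    obtain ⟨δ, h⟩ := hA x hx
    rw [weightedHomogeneousComponent_of_mem h]
    split_ifs
    · exact Ideal.subset_span hx
    · simp
  | smul r x hx ih =>
    intro b
    induction r using MvPolynomial.induction_on' with
    | monomial u a => 
      have h1 : IsWeightedHomogeneous (wt κ d) (monomial u a : Rg κ d) (Finsupp.weight (wt κ d) u) :=
        isWeightedHomogeneous_monomial _ _ _ rfl
      rw [smul_eq_mul, mul_comm, comp_mul h1]
      split_ifs
      · exact Ideal.mul_mem_right _ _ (ih _)
      · simp
    | add p q hp hq => 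
      rw [add_smul, map_add]; exact Ideal.add_mem _ hp hq

/-- the degree `b` part of the quotient ring -/
def Mg (J : Ideal (Rg κ d)) (b : κ → ℕ) : Submodule ℝ (Rg κ d ⧸ J) :=
  (Sg κ d b).map (Ideal.Quotient.mkₐ ℝ J).toLinearMap

instance finM (J : Ideal (Rg κ d)) (b : κ → ℕ) : Module.Finite ℝ (Mg J b) := by
  unfold Mg; infer_instance

/-- Hilbert function -/
def hf (J : Ideal (Rg κ d)) (b : κ → ℕ) : ℕ := finrank ℝ (Mg J b)

lemma finrank_map_add {E F : Type*} [AddCommGroup E] [Module ℝ E] [AddCommGroup F] [Module ℝ F]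
    (W : Submodule ℝ E) [Module.Finite ℝ W] (f : E →ₗ[ℝ] F) :
    finrank ℝ (W.map f) + finrank ℝ (W ⊓ LinearMap.ker f : Submodule ℝ E) = finrank ℝ W := by
  have h := (f.domRestrict W).finrank_range_add_finrank_ker
  rw [LinearMap.range_domRestrict] at h
  rw [← h]
  congr 1
  have : W ⊓ LinearMap.ker f = (LinearMap.ker (f.domRestrict W)).map W.subtype := by
    ext x
    simp only [Submodule.mem_inf, LinearMap.mem_ker, Submodule.mem_map, Submodule.subtype_apply,
      LinearMap.domRestrict_apply, Subtype.exists, exists_and_right, exists_eq_right]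
    constructor
    · rintro ⟨a, b⟩; exact ⟨a, b⟩
    · rintro ⟨a, b⟩; exact ⟨a, b⟩
  rw [this]
  exact (Submodule.finrank_map_subtype_eq W _).symm ▸ rfl

lemma finrank_map_le3 {E E1 E2 E3 : Type*} [AddCommGroup E] [Module ℝ E]
    [AddCommGroup E1] [Module ℝ E1] [AddCommGroup E2] [Module ℝ E2] [AddCommGroup E3] [Module ℝ E3]
    (W W3 : Submodule ℝ E) [Module.Finite ℝ W] [Module.Finite ℝ W3]
    (f1 : E →ₗ[ℝ] E1) (f2 : E →ₗ[ℝ] E2) (f3 : E →ₗ[ℝ] E3) (m : E →ₗ[ℝ] E)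
    (h12 : ∀ y, f1 y = 0 → f2 y = 0)
    (h3 : ∀ r, f3 r = 0 → f1 (m r) = 0)
    (h2 : ∀ y ∈ W, f2 y = 0 → ∃ r ∈ W3, f1 y = f1 (m r)) :
    finrank ℝ (W.map f1) ≤ finrank ℝ (W.map f2) + finrank ℝ (W3.map f3) := by
  have a1 := finrank_map_add W f1
  have a2 := finrank_map_add W f2
  have a3 := finrank_map_add W3 f3
  have a4 := finrank_map_add W3 (f1 ∘ₗ m)
  have : Module.Finite ℝ (W ⊓ LinearMap.ker f2 : Submodule ℝ E) :=
    Submodule.finiteDimensional_of_le (inf_le_left (a := W))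
  have : Module.Finite ℝ (W3 ⊓ LinearMap.ker (f1 ∘ₗ m) : Submodule ℝ E) :=
    Submodule.finiteDimensional_of_le (inf_le_left (a := W3))
  have a5 := finrank_map_add (W ⊓ LinearMap.ker f2) f1
  have e1 : W ⊓ LinearMap.ker f2 ⊓ LinearMap.ker f1 = W ⊓ LinearMap.ker f1 := by
    ext y
    simp only [Submodule.mem_inf, LinearMap.mem_ker]
    have := h12 y
    tauto
  rw [e1] at a5
  have e2 : finrank ℝ (Submodule.map f1 (W ⊓ LinearMap.ker f2)) ≤
      finrank ℝ (W3.map (f1 ∘ₗ m)) := by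
    apply Submodule.finrank_mono
    rintro _ ⟨y, hy, rfl⟩
    obtain ⟨r, hr, h⟩ := h2 y hy.1 hy.2
    exact ⟨r, hr, h.symm⟩
  have e3 : finrank ℝ (W3 ⊓ LinearMap.ker f3 : Submodule ℝ E) ≤
      finrank ℝ (W3 ⊓ LinearMap.ker (f1 ∘ₗ m) : Submodule ℝ E) := by
    apply Submodule.finrank_mono
    rintro y hy
    exact ⟨hy.1, h3 y hy.2⟩
  omega

lemma hf_step {J : Ideal (Rg κ d)} (hJ : IsHom J) {L G : Rg κ d} {δ : κ → ℕ}
    (hL : IsWeightedHomogeneous (wt κ d) L δ) (a : κ → ℕ) :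
    hf (J ⊔ Ideal.span {L * G}) (a + δ) ≤
      hf (J ⊔ Ideal.span {L}) (a + δ) + hf (J ⊔ Ideal.span {G}) a := by
  unfold hf Mg
  refine finrank_map_le3 _ _ _ _ _ (LinearMap.mulLeft ℝ L) ?_ ?_ ?_
  · intro y hy
    simp only [AlgHom.toLinearMap_apply, Ideal.Quotient.mkₐ_eq_mk, Ideal.Quotient.eq_zero_iff_mem] at hy ⊢
    revert y
    change J ⊔ Ideal.span {L * G} ≤ J ⊔ Ideal.span {L}
    refine sup_le_sup_left ?_ _
    rw [Ideal.span_singleton_le_iff_mem, Ideal.mem_span_singleton]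
    exact Dvd.intro _ rfl
  · intro y hy
    simp only [AlgHom.toLinearMap_apply, Ideal.Quotient.mkₐ_eq_mk, Ideal.Quotient.eq_zero_iff_mem,
      LinearMap.mulLeft_apply, Submodule.mem_sup, Ideal.mem_span_singleton'] at hy ⊢
    obtain ⟨u, hu, _, ⟨v, rfl⟩, rfl⟩ := hy
    exact ⟨L * u, Ideal.mul_mem_left _ _ hu, _, ⟨v, rfl⟩, by ring⟩
  · intro y hyS hy
    simp only [AlgHom.toLinearMap_apply, Ideal.Quotient.mkₐ_eq_mk, Ideal.Quotient.eq_zero_iff_mem,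
      LinearMap.mulLeft_apply, Submodule.mem_sup, Ideal.mem_span_singleton'] at hy ⊢
    obtain ⟨u, hu, _, ⟨v, rfl⟩, rfl⟩ := hy
    refine ⟨weightedHomogeneousComponent (wt κ d) a v, weightedHomogeneousComponent_mem _ _ _, ?_⟩
    rw [Ideal.Quotient.eq]
    have h1 := IsWeightedHomogeneous.weightedHomogeneousComponent_same hyS
    rw [map_add, comp_mul hL, if_pos (le_add_of_nonneg_left zero_le), add_tsub_cancel_right] at h1
    rw [← h1, mul_comm L ((weightedHomogeneousComponent (wt κ d) a) v), add_sub_cancel_right]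
    exact Ideal.mem_sup_left (hJ u hu _)

def EvB (J : Ideal (Rg κ d)) (N : ℕ) : Prop := ∃ b0 : κ → ℕ, ∀ b, b0 ≤ b → hf J b ≤ N

lemma evB_step {J : Ideal (Rg κ d)} (hJ : IsHom J) {L G : Rg κ d} {δ : κ → ℕ}
    (hL : IsWeightedHomogeneous (wt κ d) L δ) {N1 N2 : ℕ} (h1 : EvB (J ⊔ Ideal.span {L}) N1)
    (h2 : EvB (J ⊔ Ideal.span {G}) N2) : EvB (J ⊔ Ideal.span {L * G}) (N1 + N2) := by
  obtain ⟨b1, h1⟩ := h1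
  obtain ⟨b2, h2⟩ := h2
  refine ⟨b1 + b2 + δ, fun b hb => ?_⟩
  obtain ⟨c, rfl⟩ := le_iff_exists_add.1 hb
  have := hf_step hJ (G := G) hL (b1 + b2 + c)
  have e : b1 + b2 + δ + c = b1 + b2 + c + δ := by abel
  rw [e]
  refine this.trans (add_le_add (h1 _ ?_) (h2 _ ?_))
  · rw [add_assoc, add_assoc]; exact le_self_add
  · rw [add_comm b1 b2, add_assoc]; exact le_self_add

lemma evB_top : EvB (⊤ : Ideal (Rg κ d)) 0 := by
  refine ⟨0, fun b _ => ?_⟩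
  unfold hf
  have : Mg (⊤ : Ideal (Rg κ d)) b = ⊥ := by
    rw [eq_bot_iff]
    rintro _ ⟨y, _, rfl⟩
    simp only [AlgHom.toLinearMap_apply, Ideal.Quotient.mkₐ_eq_mk, Submodule.mem_bot, Ideal.Quotient.eq_zero_iff_mem]
    trivial
  rw [this]; simp

lemma evB_prod {T : Type*} {J : Ideal (Rg κ d)} (hJ : IsHom J) (s : Finset T) (L : T → Rg κ d)
    (δ : T → κ → ℕ) (N : T → ℕ)
    (hL : ∀ p ∈ s, IsWeightedHomogeneous (wt κ d) (L p) (δ p))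
    (h : ∀ p ∈ s, EvB (J ⊔ Ideal.span {L p}) (N p)) :
    EvB (J ⊔ Ideal.span {∏ p ∈ s, L p}) (∑ p ∈ s, N p) := by
  classical
  induction s using Finset.induction_on with
  | empty =>
    simp only [Finset.prod_empty, Finset.sum_empty, Ideal.span_singleton_one]
    rw [sup_top_eq]; exact evB_top
  | insert p s hp ih =>
    rw [Finset.prod_insert hp, Finset.sum_insert hp]
    refine evB_step hJ (hL p (by simp)) (h p (by simp)) (ih ?_ ?_)
    · intro q hq; exact hL q (by simp [hq])
    · intro q hq; exact h q (by simp [hq])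

end BU

end part_PA

section part_PB
open MvPolynomial Module

set_option linter.unusedSectionVars false
set_option linter.style.haveILetI false
namespace BU

variable {κ : Type} [Fintype κ] [DecidableEq κ] {d : ℕ}

lemma vand_mem {E : Type*} [AddCommGroup E] [Module ℝ E] (N : Submodule ℝ E) (x : Fin (d + 1) → E)
    (Z : Finset ℝ) (hZ : d + 1 ≤ Z.card) (h : ∀ s ∈ Z, ∑ l : Fin (d + 1), s ^ (l : ℕ) • x l ∈ N)
    (l : Fin (d + 1)) : x l ∈ N := by
  obtain ⟨Z', hZ', hc⟩ := Finset.exists_subset_card_eq hZ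
  let v : Fin (d + 1) → ℝ := fun i => Z'.orderEmbOfFin hc i
  have hv : Function.Injective v := (Z'.orderEmbOfFin hc).injective
  have hvZ : ∀ i, v i ∈ Z := fun i => hZ' (Finset.orderEmbOfFin_mem Z' hc i)
  have hdet : IsUnit (Matrix.vandermonde v).det :=
    isUnit_iff_ne_zero.2 (Matrix.det_vandermonde_ne_zero_iff.2 hv)
  have key : x l = ∑ i, (Matrix.vandermonde v)⁻¹ l i • ∑ l' : Fin (d + 1), v i ^ (l' : ℕ) • x l' := by
    have h1 := Matrix.nonsing_inv_mul _ hdet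
    simp only [Finset.smul_sum, smul_smul]
    rw [Finset.sum_comm]
    simp only [← Finset.sum_smul]
    have h2 : ∀ l' : Fin (d + 1), ∑ i, (Matrix.vandermonde v)⁻¹ l i * v i ^ (l' : ℕ) = if l = l' then 1 else 0 := by
      intro l'
      have := congrFun (congrFun h1 l) l'
      rw [Matrix.mul_apply, Matrix.one_apply] at this
      simpa [Matrix.vandermonde_apply] using this
    simp [h2]
  rw [key]
  exact Submodule.sum_mem _ fun i _ => Submodule.smul_mem _ _ (h _ (hvZ i))

/-- the linear form in group `j` attached to the node `s` -/
def form (j : κ) (s : ℝ) : Rg κ d := ∑ l : Fin (d + 1), s ^ (l : ℕ) • X (j, l)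

lemma form_zero (j : κ) : (form j 0 : Rg κ d) = X (j, 0) := by
  unfold form
  rw [Fin.sum_univ_succ]
  simp

lemma form_hom (j : κ) (s : ℝ) :
    IsWeightedHomogeneous (wt κ d) (form j s : Rg κ d) (Pi.single j 1) := by
  rw [← mem_weightedHomogeneousSubmodule]
  exact Submodule.sum_mem _ fun l _ => Submodule.smul_mem _ _ (isWeightedHomogeneous_X ℝ _ (j, l))

lemma eval_form (j : κ) (s : ℝ) (x : κ × Fin (d + 1) → ℝ) :
    eval x (form j s) = ∑ l : Fin (d + 1), s ^ (l : ℕ) * x (j, l) := by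
  simp [form, smul_eq_C_mul]

lemma hom_eval {A : Type*} [CommRing A] [Algebra ℝ A] (lam : κ × Fin (d + 1) → ℝ) (ell : κ → A)
    {f : Rg κ d} {b : κ → ℕ} (hf : IsWeightedHomogeneous (wt κ d) f b) :
    aeval (fun s => lam s • ell s.1) f = eval lam f • ∏ j, ell j ^ b j := by
  rw [MvPolynomial.aeval_def, eval₂_eq', MvPolynomial.eval_eq', Finset.sum_smul]
  refine Finset.sum_congr rfl fun m hm => ?_
  have hw := hf (mem_support_iff.1 hm)
  have e1 : ∏ i : κ × Fin (d + 1), (lam i • ell i.1) ^ m i =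
      (∏ i, lam i ^ m i) • ∏ j, ell j ^ b j := by
    simp only [Algebra.smul_def, mul_pow, Finset.prod_mul_distrib, ← map_pow, ← map_prod]
    congr 1
    rw [Fintype.prod_prod_type]
    refine Finset.prod_congr rfl fun j _ => ?_
    rw [← hw, weight_apply, ← Finset.prod_pow_eq_pow_sum]
  rw [e1, ← Algebra.smul_def, smul_smul]

lemma algHom_hom {A : Type*} [CommRing A] [Algebra ℝ A] (φ : Rg κ d →ₐ[ℝ] A)
    (lam : κ × Fin (d + 1) → ℝ) (ell : κ → A) (h : ∀ s, φ (X s) = lam s • ell s.1)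
    {f : Rg κ d} {b : κ → ℕ} (hf : IsWeightedHomogeneous (wt κ d) f b) :
    φ f = eval lam f • ∏ j, ell j ^ b j := by
  rw [← hom_eval lam ell hf]
  have : φ = aeval (fun s => lam s • ell s.1) := by
    apply MvPolynomial.algHom_ext
    intro s
    rw [h, aeval_X]
  rw [← this]

lemma base_one (J : Ideal (Rg κ d)) (ell : κ → Rg κ d)
    (h : ∀ s : κ × Fin (d + 1), ∃ c : ℝ, X s - c • ell s.1 ∈ J) (b : κ → ℕ) : hf J b ≤ 1 := by
  choose lam hlam using h
  unfold hf
  have hle : Mg J b ≤ Submodule.span ℝ {∏ j, (Ideal.Quotient.mkₐ ℝ J (ell j)) ^ b j} := by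
    rintro _ ⟨f, hf, rfl⟩
    rw [AlgHom.toLinearMap_apply, algHom_hom (Ideal.Quotient.mkₐ ℝ J) lam
      (fun j => Ideal.Quotient.mkₐ ℝ J (ell j)) ?_ hf]
    · exact Submodule.smul_mem _ _ (Submodule.mem_span_singleton_self _)
    · intro s
      rw [← map_smul]
      exact (Ideal.Quotient.eq).2 (hlam s)
  refine (Submodule.finrank_mono hle).trans ?_
  have := finrank_span_finset_le_card (R := ℝ)
    ({∏ j, (Ideal.Quotient.mkₐ ℝ J (ell j)) ^ b j} : Finset (Rg κ d ⧸ J))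
  rwa [Finset.coe_singleton, Finset.card_singleton] at this

lemma base_zero (J : Ideal (Rg κ d)) (j : κ) (h : ∀ l, X (j, l) ∈ J) (b : κ → ℕ) (hb : 1 ≤ b j) :
    hf J b = 0 := by
  unfold hf
  have hle : Mg J b = ⊥ := by
    rw [eq_bot_iff]
    rintro _ ⟨f, hf, rfl⟩
    rw [Submodule.mem_bot, AlgHom.toLinearMap_apply]
    refine Ideal.Quotient.eq_zero_iff_mem.2 ?_
    rw [f.as_sum]
    refine Ideal.sum_mem _ fun m hm => ?_
    have hw := hf (mem_support_iff.1 hm)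
    have h1 : ∃ l, m (j, l) ≠ 0 := by
      by_contra hcon
      push Not at hcon
      have := weight_apply m j
      rw [hw] at this
      simp [hcon] at this
      omega
    obtain ⟨l, hl⟩ := h1
    have : (X (j, l) : Rg κ d) ∣ monomial m (coeff m f) := by
      rw [X_dvd_monomial]; exact Or.inr hl
    exact Ideal.mem_of_dvd _ this (h l)
  rw [hle]; simp

lemma evB_multi {I T : Type} [Fintype I] [DecidableEq I] [DecidableEq T] (Tset : I → Finset T)
    (L : I → T → Rg κ d) (δ : T → κ → ℕ)
    (hL : ∀ i p, IsWeightedHomogeneous (wt κ d) (L i p) (δ p)) (B : Set (Rg κ d))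
    (hB : ∀ g ∈ B, ∃ δ, IsWeightedHomogeneous (wt κ d) g δ)
    (N0 : (I → T) → ℕ)
    (base : ∀ c ∈ Fintype.piFinset Tset,
      EvB (Ideal.span (B ∪ Set.range (fun i => L i (c i)))) (N0 c))
    (hne : (Fintype.piFinset Tset).Nonempty) :
    EvB (Ideal.span (B ∪ Set.range (fun i => ∏ p ∈ Tset i, L i p)))
      (∑ c ∈ Fintype.piFinset Tset, N0 c) := by
  have main : ∀ s : Finset I, ∀ c ∈ Fintype.piFinset Tset,
      EvB (Ideal.span (B ∪ Set.range (fun i => if i ∈ s then ∏ p ∈ Tset i, L i p else L i (c i))))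
      (∑ c' ∈ Fintype.piFinset (fun i => if i ∈ s then Tset i else {c i}), N0 c') := by
    intro s
    induction s using Finset.induction_on with
    | empty =>
      intro c hc
      simp only [Finset.notMem_empty, if_false]
      rw [Fintype.piFinset_singleton]
      simpa using base c hc
    | insert i s hi ih =>
      intro c hc
      set J0 : Set (Rg κ d) :=
        B ∪ (fun i => if i ∈ s then ∏ p ∈ Tset i, L i p else L i (c i)) '' {i}ᶜ with hJ0
      have hom0 : IsHom (Ideal.span J0) := by
        apply isHom_span
        rintro g (hg | ⟨i', _, rfl⟩)
        · exact hB g hg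
        · dsimp only
          split_ifs
          · exact ⟨_, IsWeightedHomogeneous.prod _ _ _ (fun p _ => hL i' p)⟩
          · exact ⟨_, hL _ _⟩
      have gen : ∀ f : I → Rg κ d,
          (∀ i', i' ≠ i → f i' = if i' ∈ s then ∏ p ∈ Tset i', L i' p else L i' (c i')) →
          Ideal.span (B ∪ Set.range f) = Ideal.span J0 ⊔ Ideal.span {f i} := by
        intro f hf
        rw [← Ideal.span_union, hJ0, Set.union_assoc]
        congr 2
        ext g
        simp only [Set.mem_range, Set.mem_union, Set.mem_image, Set.mem_compl_iff,
          Set.mem_singleton_iff]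
        constructor
        · rintro ⟨i', rfl⟩
          by_cases h : i' = i
          · right; rw [h]
          · left; exact ⟨i', h, (hf i' h).symm⟩
        · rintro (⟨i', h, rfl⟩ | rfl)
          · exact ⟨i', hf i' h⟩
          · exact ⟨i, rfl⟩
      rw [gen]
      · simp only [Finset.mem_insert_self, if_true]
        have hsum : ∑ c' ∈ Fintype.piFinset (fun i' => if i' ∈ insert i s then Tset i' else {c i'}), N0 c'
            = ∑ p ∈ Tset i, ∑ c' ∈ Fintype.piFinset
              (fun i' => if i' ∈ s then Tset i' else {Function.update c i p i'}), N0 c' := by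
          rw [← Finset.sum_fiberwise_of_maps_to (g := fun c' : I → T => c' i) (t := Tset i)]
          · refine Finset.sum_congr rfl fun p hp => ?_
            refine Finset.sum_congr ?_ fun _ _ => rfl
            ext c'
            simp only [Finset.mem_filter, Fintype.mem_piFinset]
            constructor
            · rintro ⟨h1, h2⟩ i'
              by_cases h : i' = i
              · subst h; simp [hi, h2]
              · have := h1 i'
                simpa [Finset.mem_insert, h, Function.update_of_ne h] using this
            · intro h1
              have h2 : c' i = p := by simpa [hi] using h1 i
              refine ⟨fun i' => ?_, h2⟩
              by_cases h : i' = i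
              · subst h; simp [h2, hp]
              · simpa [Finset.mem_insert, h, Function.update_of_ne h] using h1 i'
          · intro c' hc'
            simpa using Fintype.mem_piFinset.1 hc' i
        rw [hsum]
        refine evB_prod hom0 _ _ δ _ (fun p _ => hL i p) fun p hp => ?_
        have hup : Function.update c i p ∈ Fintype.piFinset Tset := by
          rw [Fintype.mem_piFinset] at hc ⊢
          intro i'
          by_cases h : i' = i
          · subst h; simpa using hp
          · simpa [h] using hc i'
        have := ih _ hup
        rw [gen] at this
        · simpa [hi] using this
        · intro i' h
          simp [Function.update_of_ne h]
      · intro i' h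
        simp [Finset.mem_insert, h]
  obtain ⟨c, hc⟩ := hne
  simpa using main Finset.univ c hc

end BU

end part_PB

section part_PC
open MvPolynomial Module

set_option linter.unusedSectionVars false
set_option linter.style.haveILetI false
namespace BU

variable {κ : Type} [Fintype κ] [DecidableEq κ] {d : ℕ}

abbrev Tt (κ : Type) := Σ _ : κ, ℕ

lemma node_exists (I κ : Type) [Fintype I] [Fintype κ] : ∃ ν : I → Tt κ → ℝ, (∀ i p, ν i p ≠ 0) ∧
    ∀ i p i' p', ν i p = ν i' p' → i = i' ∧ p = p' := by
  obtain ⟨f, hf⟩ := exists_injective_nat (I × Tt κ)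
  refine ⟨fun i p => (f (i, p) : ℝ) + 1, fun i p => by positivity, fun i p i' p' h => ?_⟩
  have h1 : f (i, p) = f (i', p') := by
    have : (f (i, p) : ℝ) = f (i', p') := by linarith
    exact_mod_cast this
  have := hf h1
  simpa using this

def node (I κ : Type) [Fintype I] [Fintype κ] : I → Tt κ → ℝ := (node_exists I κ).choose

variable {I : Type} [Fintype I] [DecidableEq I]

lemma node_ne (i : I) (p : Tt κ) : node I κ i p ≠ 0 := (node_exists I κ).choose_spec.1 i p
lemma node_inj {i i' : I} {p p' : Tt κ} (h : node I κ i p = node I κ i' p') : i = i' ∧ p = p' :=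
  (node_exists I κ).choose_spec.2 i p i' p' h

def Lf (d : ℕ) (i : I) (p : Tt κ) : Rg κ d := form p.1 (node I κ i p)

def Tset (e : I → κ → ℕ) (i : I) : Finset (Tt κ) :=
  (Finset.univ : Finset κ).sigma (fun j => Finset.range (e i j))

def Gf (d : ℕ) (e : I → κ → ℕ) (i : I) : Rg κ d := ∏ p ∈ Tset e i, Lf d i p

lemma Lf_hom (i : I) (p : Tt κ) :
    IsWeightedHomogeneous (wt κ d) (Lf d i p) (Pi.single p.1 1) := form_hom _ _

lemma sum_Tset (e : I → κ → ℕ) (i : I) :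
    ∑ p ∈ Tset e i, (Pi.single p.1 1 : κ → ℕ) = e i := by
  unfold Tset
  rw [Finset.sum_sigma]
  simp only [Finset.sum_const, Finset.card_range]
  ext j
  simp [Finset.sum_apply, Pi.single_apply]

lemma Gf_hom (e : I → κ → ℕ) (i : I) : IsWeightedHomogeneous (wt κ d) (Gf d e i) (e i) := by
  have := IsWeightedHomogeneous.prod (Tset e i) (fun p => Lf d i p)
    (fun p => (Pi.single p.1 1 : κ → ℕ)) (fun p _ => Lf_hom i p)
  rwa [sum_Tset] at this

def cnt (c : I → Tt κ) (j : κ) : ℕ := (Finset.univ.filter (fun i => (c i).1 = j)).card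

def bal (d : ℕ) (c : I → Tt κ) : Prop := ∀ j, cnt c j = d

lemma not_bal (hI : Fintype.card I = Fintype.card κ * d) {c : I → Tt κ} (h : ¬ bal d c) :
    ∃ j, d + 1 ≤ cnt c j := by
  by_contra hcon
  push Not at hcon
  apply h
  have hsum : ∑ j, cnt c j = ∑ _j : κ, d := by
    rw [Finset.sum_const, Finset.card_univ, smul_eq_mul, ← hI]
    unfold cnt
    rw [← Finset.card_eq_sum_card_fiberwise (f := fun i => (c i).1) (s := Finset.univ) (t := Finset.univ)]
    · rfl
    · intro _ _; simp
  have := (Finset.sum_eq_sum_iff_of_le (fun j _ => Nat.lt_succ_iff.1 (hcon j))).1 hsum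
  intro j; exact this j (Finset.mem_univ j)

def Zs (c : I → Tt κ) (j : κ) : Finset ℝ :=
  (Finset.univ.filter (fun i => (c i).1 = j)).image (fun i => node I κ i (c i))

lemma card_Zs (c : I → Tt κ) (j : κ) : (Zs c j).card = cnt c j := by
  unfold Zs cnt
  exact Finset.card_image_of_injective _ (fun i i' h => (node_inj h).1)

lemma zero_notMem_Zs (c : I → Tt κ) (j : κ) : (0 : ℝ) ∉ Zs c j := by
  unfold Zs
  simp [node_ne]

lemma form_mem_of_Zs {c : I → Tt κ} {j : κ} {J : Ideal (Rg κ d)} (h : ∀ i, Lf d i (c i) ∈ J)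
    {s : ℝ} (hs : s ∈ Zs c j) : form j s ∈ J := by
  unfold Zs at hs
  simp only [Finset.mem_image, Finset.mem_filter, Finset.mem_univ, true_and] at hs
  obtain ⟨i, rfl, rfl⟩ := hs
  exact h i

lemma over_mem {c : I → Tt κ} {j : κ} {J : Ideal (Rg κ d)} (h : ∀ i, Lf d i (c i) ∈ J)
    (hj : d + 1 ≤ cnt c j) (l : Fin (d + 1)) : X (j, l) ∈ J := by
  have := vand_mem (J.restrictScalars ℝ) (fun l => (X (j, l) : Rg κ d)) (Zs c j)
    (by rwa [card_Zs]) (fun s hs => form_mem_of_Zs h hs) l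
  simpa using this

lemma over_mem' {c : I → Tt κ} {j : κ} {J : Ideal (Rg κ d)} (h : ∀ i, Lf d i (c i) ∈ J)
    (hj : cnt c j = d) (hX : X (j, 0) ∈ J) (l : Fin (d + 1)) : X (j, l) ∈ J := by
  have := vand_mem (J.restrictScalars ℝ) (fun l => (X (j, l) : Rg κ d)) (insert 0 (Zs c j))
    (by rw [Finset.card_insert_of_notMem (zero_notMem_Zs c j), card_Zs, hj]) (fun s hs => by
      rcases Finset.mem_insert.1 hs with rfl | hs
      · change form j 0 ∈ J; rw [form_zero]; exact hX
      · exact form_mem_of_Zs h hs) l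
  simpa using this

lemma bal_mem {c : I → Tt κ} {J : Ideal (Rg κ d)} (h : ∀ i, Lf d i (c i) ∈ J)
    (hb : bal d c) (s : κ × Fin (d + 1)) : ∃ r : ℝ, X s - r • X (s.1, 0) ∈ J := by
  obtain ⟨j, l⟩ := s
  have := vand_mem (J.restrictScalars ℝ ⊔ Submodule.span ℝ {X (j, 0)})
    (fun l => (X (j, l) : Rg κ d)) (insert 0 (Zs c j))
    (by rw [Finset.card_insert_of_notMem (zero_notMem_Zs c j), card_Zs, hb]) (fun s hs => by
      rcases Finset.mem_insert.1 hs with rfl | hs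
      · change form j 0 ∈ _; rw [form_zero]
        exact Submodule.mem_sup_right (Submodule.mem_span_singleton_self _)
      · exact Submodule.mem_sup_left (form_mem_of_Zs h hs)) l
  obtain ⟨y, hy, z, hz, hyz⟩ := Submodule.mem_sup.1 this
  obtain ⟨r, rfl⟩ := Submodule.mem_span_singleton.1 hz
  refine ⟨r, ?_⟩
  rw [← hyz]; simpa using hy

open scoped Classical in
/-- the set of balanced choices -/
def BC (d : ℕ) (e : I → κ → ℕ) : Finset (I → Tt κ) :=
  (Fintype.piFinset (Tset e)).filter (bal d)

lemma evB_zero_of {J : Ideal (Rg κ d)} {j : κ} (h : ∀ l, X (j, l) ∈ J) : EvB J 0 :=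
  ⟨1, fun b hb => (base_zero J j h b (hb j)).le⟩

lemma up1 (e : I → κ → ℕ) (hI : Fintype.card I = Fintype.card κ * d) (hne : (BC d e).Nonempty) :
    EvB (Ideal.span (Set.range (Gf d e))) (BC d e).card := by
  classical
  have := evB_multi (Tset e) (fun i p => Lf d i p) (fun p => (Pi.single p.1 1 : κ → ℕ))
    (fun i p => Lf_hom i p) ∅ (by simp) (fun c => if bal d c then 1 else 0) ?_
    (hne.mono (Finset.filter_subset _ _))
  · rw [Set.empty_union, ← Finset.sum_filter, Finset.sum_const, smul_eq_mul, mul_one] at this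
    have h2 : (BC d e).card = ((Fintype.piFinset (Tset e)).filter (fun c => bal d c)).card := by
      unfold BC; congr
    rw [h2]; exact this
  · intro c hc
    have hm : ∀ i, Lf d i (c i) ∈ Ideal.span (∅ ∪ Set.range (fun i => Lf d i (c i))) := fun i =>
      Ideal.subset_span (Or.inr ⟨i, rfl⟩)
    split_ifs with hb
    · exact ⟨0, fun b _ => base_one _ (fun j => X (j, 0)) (bal_mem hm hb) b⟩
    · obtain ⟨j, hj⟩ := not_bal hI hb
      exact evB_zero_of (over_mem hm hj)

lemma up2 (e : I → κ → ℕ) (hI : Fintype.card I = Fintype.card κ * d) (hne : (BC d e).Nonempty)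
    (j0 : κ) :
    EvB (Ideal.span ({X (j0, 0)} ∪ Set.range (Gf d e))) 0 := by
  classical
  have := evB_multi (Tset e) (fun i p => Lf d i p) (fun p => (Pi.single p.1 1 : κ → ℕ))
    (fun i p => Lf_hom i p) {X (j0, 0)} (fun g hg => by
      rw [Set.mem_singleton_iff.1 hg]; exact ⟨_, isWeightedHomogeneous_X ℝ _ _⟩) (fun c => 0) ?_
    (hne.mono (Finset.filter_subset _ _))
  · rw [Finset.sum_const_zero] at this
    exact this
  · intro c hc
    have hm : ∀ i, Lf d i (c i) ∈ Ideal.span ({X (j0, 0)} ∪ Set.range (fun i => Lf d i (c i))) :=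
      fun i => Ideal.subset_span (Or.inr ⟨i, rfl⟩)
    by_cases hb : bal d c
    · exact evB_zero_of (over_mem' hm (hb j0) (Ideal.subset_span (Or.inl rfl)))
    · obtain ⟨j, hj⟩ := not_bal hI hb
      exact evB_zero_of (over_mem hm hj)

end BU

end part_PC

section part_PD
open MvPolynomial Module

set_option linter.unusedSectionVars false
set_option linter.style.haveILetI false
namespace BU

variable {κ : Type} [Fintype κ] [DecidableEq κ] {d : ℕ}

lemma linindep_cofinite {E : Type*} [AddCommGroup E] [Module ℝ E] {r : ℕ} (u v : Fin r → E)
    (hu : LinearIndependent ℝ u) :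
    {t : ℝ | ¬ LinearIndependent ℝ (fun k => u k + t • v k)}.Finite := by
  have hinj : LinearMap.ker (Fintype.linearCombination ℝ u) = ⊥ := by
    rw [LinearMap.ker_eq_bot]
    exact linearIndependent_iff_injective_fintypeLinearCombination.1 hu
  obtain ⟨g, hg⟩ := LinearMap.exists_leftInverse_of_injective _ hinj
  have hgu : ∀ k, g (u k) = Pi.single k 1 := by
    intro k
    have := LinearMap.congr_fun hg (Pi.single k 1)
    simpa using this
  let M : Matrix (Fin r) (Fin r) ℝ := Matrix.of fun k => g (v k)
  let p : Polynomial ℝ := (1 + (Polynomial.X : Polynomial ℝ) • M.map Polynomial.C).det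
  have hp : ∀ t, p.eval t = (1 + t • M).det := by
    intro t
    have := RingHom.map_det (Polynomial.evalRingHom t) (1 + (Polynomial.X : Polynomial ℝ) • M.map Polynomial.C)
    rw [Polynomial.coe_evalRingHom] at this
    rw [this]
    congr 1
    ext i j
    by_cases h : i = j <;> simp [h] <;> ring
  have hp0 : p ≠ 0 := by
    intro h
    have := hp 0
    rw [h] at this
    simp at this
  refine (p.roots.toFinset.finite_toSet).subset ?_
  intro t ht
  simp only [Finset.mem_coe, Multiset.mem_toFinset, Polynomial.mem_roots hp0, Polynomial.IsRoot.def]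
  by_contra hne
  rw [hp] at hne
  apply ht
  apply LinearIndependent.of_comp g
  have : (⇑g ∘ fun k => u k + t • v k) = (1 + t • M).row := by
    ext k j
    simp [hgu, M, Matrix.one_apply, Pi.single_apply, eq_comm]
  rw [this]
  exact Matrix.linearIndependent_rows_of_isUnit ((Matrix.isUnit_iff_isUnit_det _).2 (isUnit_iff_ne_zero.2 hne))

lemma span_hom_repr {ι : Type} [Fintype ι] {A : ι → Rg κ d} {ε : ι → κ → ℕ}
    (hA : ∀ i, IsWeightedHomogeneous (wt κ d) (A i) (ε i)) {y : Rg κ d} {b : κ → ℕ}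
    (hy : y ∈ Sg κ d b) (hyA : y ∈ Ideal.span (Set.range A)) :
    ∃ h : ι → Rg κ d, y = ∑ i, h i * A i ∧
      ∀ i, ∀ f, IsWeightedHomogeneous (wt κ d) f (ε i) → h i * f ∈ Sg κ d b := by
  classical
  rw [Ideal.mem_span_range_iff_exists_fun] at hyA
  obtain ⟨c, hc⟩ := hyA
  refine ⟨fun i => if ε i ≤ b then weightedHomogeneousComponent (wt κ d) (b - ε i) (c i) else 0, ?_, ?_⟩
  · have h1 := IsWeightedHomogeneous.weightedHomogeneousComponent_same hy
    rw [← h1, ← hc, map_sum]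
    refine Finset.sum_congr rfl fun i _ => ?_
    rw [comp_mul (hA i)]
    simp only [ite_mul, zero_mul]
  · intro i f hf
    dsimp only
    split_ifs with h
    · have := (weightedHomogeneousComponent_isWeightedHomogeneous (w := wt κ d) (b - ε i) (c i)).mul hf
      rwa [tsub_add_cancel_of_le h] at this
    · simp

lemma hf_add (J : Ideal (Rg κ d)) (b : κ → ℕ) :
    hf J b + finrank ℝ (Sg κ d b ⊓ J.restrictScalars ℝ : Submodule ℝ (Rg κ d)) =
      finrank ℝ (Sg κ d b) := by
  have : LinearMap.ker (Ideal.Quotient.mkₐ ℝ J).toLinearMap = J.restrictScalars ℝ := by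
    ext x
    simp [Ideal.Quotient.eq_zero_iff_mem]
  rw [← this]
  exact finrank_map_add (Sg κ d b) (Ideal.Quotient.mkₐ ℝ J).toLinearMap

lemma semi0 {ι : Type} [Fintype ι] {A A' : ι → Rg κ d} {ε : ι → κ → ℕ}
    (hA : ∀ i, IsWeightedHomogeneous (wt κ d) (A i) (ε i))
    (hA' : ∀ i, IsWeightedHomogeneous (wt κ d) (A' i) (ε i)) (b : κ → ℕ) (N : ℕ)
    (h : hf (Ideal.span (Set.range A)) b ≤ N) :
    {t : ℝ | ¬ hf (Ideal.span (Set.range fun i => A i + t • A' i)) b ≤ N}.Finite := by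
  set W : Submodule ℝ (Rg κ d) := Sg κ d b ⊓ (Ideal.span (Set.range A)).restrictScalars ℝ with hW
  have : Module.Finite ℝ W := Submodule.finiteDimensional_of_le (inf_le_left (a := Sg κ d b))
  let y := Module.finBasis ℝ W
  have hrep : ∀ k, ∃ h : ι → Rg κ d, (y k : Rg κ d) = ∑ i, h i * A i ∧
      ∀ i, ∀ f, IsWeightedHomogeneous (wt κ d) f (ε i) → h i * f ∈ Sg κ d b := fun k =>
    span_hom_repr hA (y k).2.1 (y k).2.2
  choose c hc1 hc2 using hrep
  have hy : LinearIndependent ℝ (fun k => (y k : Rg κ d)) :=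
    y.linearIndependent.map' W.subtype (Submodule.ker_subtype W)
  refine (linindep_cofinite _ (fun k => ∑ i, c k i * A' i) hy).subset ?_
  intro t ht hli
  apply ht
  clear ht
  set J := Ideal.span (Set.range fun i => A i + t • A' i)
  have hmem : ∀ k, (y k : Rg κ d) + t • ∑ i, c k i * A' i ∈ Sg κ d b ⊓ J.restrictScalars ℝ := by
    intro k
    constructor
    · refine Submodule.add_mem _ (y k).2.1 (Submodule.smul_mem _ _ (Submodule.sum_mem _ fun i _ => ?_))
      exact hc2 k i _ (hA' i)
    · have : (y k : Rg κ d) + t • ∑ i, c k i * A' i = ∑ i, c k i * (A i + t • A' i) := by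
        rw [hc1, Finset.smul_sum, ← Finset.sum_add_distrib]
        refine Finset.sum_congr rfl fun i _ => ?_
        rw [mul_add, mul_smul_comm]
      rw [this]
      exact Ideal.sum_mem _ fun i _ => Ideal.mul_mem_left _ _ (Ideal.subset_span ⟨i, rfl⟩)
  have : Module.Finite ℝ (Sg κ d b ⊓ J.restrictScalars ℝ : Submodule ℝ (Rg κ d)) :=
    Submodule.finiteDimensional_of_le (inf_le_left (a := Sg κ d b))
  have hle : Submodule.span ℝ (Set.range fun k => (y k : Rg κ d) + t • ∑ i, c k i * A' i) ≤
      Sg κ d b ⊓ J.restrictScalars ℝ := by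
    rw [Submodule.span_le]
    rintro _ ⟨k, rfl⟩
    exact hmem k
  have h1 := Submodule.finrank_mono hle
  rw [finrank_span_eq_card hli, Fintype.card_fin] at h1
  have h2 := hf_add (Ideal.span (Set.range A)) b
  have h3 := hf_add J b
  rw [← hW] at h2
  omega

lemma semi {ι : Type} [Fintype ι] {A A' : ι → Rg κ d} {ε : ι → κ → ℕ}
    (hA : ∀ i, IsWeightedHomogeneous (wt κ d) (A i) (ε i))
    (hA' : ∀ i, IsWeightedHomogeneous (wt κ d) (A' i) (ε i)) (b : κ → ℕ) (N : ℕ) (t0 : ℝ)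
    (h : hf (Ideal.span (Set.range fun i => A i + t0 • A' i)) b ≤ N) :
    {t : ℝ | ¬ hf (Ideal.span (Set.range fun i => A i + t • A' i)) b ≤ N}.Finite := by
  have h0 := semi0 (A := fun i => A i + t0 • A' i) (A' := A') (ε := ε)
    (fun i => (hA i).add (Submodule.smul_mem (Sg κ d (ε i)) t0 (hA' i))) hA' b N h
  refine (h0.image (fun t => t + t0)).subset ?_
  intro t ht
  refine ⟨t - t0, ?_, by simp⟩
  simp only [Set.mem_ofPred_eq] at ht ⊢
  convert ht using 6 with i
  rw [add_assoc, ← add_smul]; simp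

end BU

end part_PD

section part_PE
open MvPolynomial Module

set_option linter.unusedSectionVars false
set_option linter.style.haveILetI false
namespace BU

variable {κ : Type} [Fintype κ] [DecidableEq κ] {d : ℕ}
variable {I : Type} [Fintype I] [DecidableEq I]

lemma contDiff_eval (f : Rg κ d) :
    ContDiff ℝ 1 (fun x : κ × Fin (d + 1) → ℝ => eval x f) := by
  induction f using MvPolynomial.induction_on with
  | C a => simpa using contDiff_const
  | add p q hp hq => simpa using hp.add hq
  | mul_X p s hp => simpa using hp.mul (contDiff_apply ℝ ℝ s)

/-- zeros persist under small perturbation -/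
lemma near_zero (hI : Fintype.card I = Fintype.card κ * d) (G F : I → Rg κ d)
    (z : κ × Fin (d + 1) → ℝ) (hz : ∀ i, eval z (G i) = 0)
    (hinj : ∀ ξ : κ × Fin (d + 1) → ℝ,
      (∀ i, HasDerivAt (fun s : ℝ => eval (z + s • ξ) (G i)) 0 0) → (∀ j, ξ (j, 0) = 0) → ξ = 0)
    (U : Set (κ × Fin (d + 1) → ℝ)) (hU : U ∈ nhds z) :
    ∀ᶠ t in nhds (0 : ℝ), ∃ x ∈ U, ∀ i, eval x (G i + t • F i) = 0 := by
  let Ψ : ℝ × (κ × Fin (d + 1) → ℝ) → ℝ × ((I → ℝ) × (κ → ℝ)) := fun y =>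
    (y.1, (fun i => eval y.2 (G i) + y.1 * eval y.2 (F i), fun j => y.2 (j, 0)))
  have hcd : ContDiff ℝ 1 Ψ := by
    refine contDiff_fst.prodMk (ContDiff.prodMk ?_ ?_)
    · rw [contDiff_pi]
      intro i
      exact ((contDiff_eval (G i)).comp contDiff_snd).add
        (contDiff_fst.mul ((contDiff_eval (F i)).comp contDiff_snd))
    · rw [contDiff_pi]
      intro j
      exact (contDiff_apply ℝ ℝ (j, (0 : Fin (d + 1)))).comp contDiff_snd
  have hs : HasStrictFDerivAt Ψ (fderiv ℝ Ψ (0, z)) (0, z) :=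
    hcd.contDiffAt.hasStrictFDerivAt (by norm_num)
  set D := fderiv ℝ Ψ (0, z) with hD
  have hker : ∀ y, D y = 0 → y = 0 := by
    rintro ⟨τ, ξ⟩ hy
    have hc : HasDerivAt (fun s : ℝ => ((0 : ℝ), z) + s • (τ, ξ)) (τ, ξ) 0 := by
      simpa using ((hasDerivAt_id (0 : ℝ)).smul_const (τ, ξ)).const_add ((0 : ℝ), z)
    have hcomp : HasDerivAt (fun s : ℝ => Ψ (((0 : ℝ), z) + s • (τ, ξ))) (D (τ, ξ)) 0 := by
      have h1 : HasFDerivAt Ψ D (((0 : ℝ), z) + (0 : ℝ) • (τ, ξ)) := by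
        simpa using hs.hasFDerivAt
      exact h1.comp_hasDerivAt 0 hc
    rw [hy] at hcomp
    have hsnd := (hasFDerivAt_snd (𝕜 := ℝ)).comp_hasDerivAt (0 : ℝ) hcomp
    have hsf := (hasFDerivAt_fst (𝕜 := ℝ)).comp_hasDerivAt (0 : ℝ) hsnd
    have hss := (hasFDerivAt_snd (𝕜 := ℝ)).comp_hasDerivAt (0 : ℝ) hsnd
    have hτ : τ = 0 := by
      have h1 : HasDerivAt (fun s : ℝ => s * τ) 0 0 := by
        have h := (hasFDerivAt_fst (𝕜 := ℝ)).comp_hasDerivAt (0 : ℝ) hcomp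
        simpa [Ψ, Function.comp_def] using h
      have h2 : HasDerivAt (fun s : ℝ => s * τ) τ 0 := by
        simpa using (hasDerivAt_id (0 : ℝ)).mul_const τ
      exact h2.unique h1
    subst hτ
    have hξ : ξ = 0 := by
      apply hinj
      · intro i
        have := (hasDerivAt_pi.1 hsf) i
        simpa [Ψ] using this
      · intro j
        have h0 := (hasDerivAt_pi.1 hss) j
        have h1 : HasDerivAt (fun s : ℝ => z (j, 0) + s * ξ (j, 0)) 0 0 := by simpa [Ψ] using h0
        have h2 : HasDerivAt (fun s : ℝ => z (j, 0) + s * ξ (j, 0)) (ξ (j, 0)) 0 := by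
          simpa using ((hasDerivAt_id (0 : ℝ)).mul_const (ξ (j, 0))).const_add (z (j, 0))
        exact h2.unique h1
    rw [hξ]; rfl
  have hsurj : D.range = ⊤ := by
    have hi : Function.Injective D.toLinearMap := by
      rw [← LinearMap.ker_eq_bot, LinearMap.ker_eq_bot']
      exact hker
    have hdim : finrank ℝ (ℝ × (κ × Fin (d + 1) → ℝ)) = finrank ℝ (ℝ × ((I → ℝ) × (κ → ℝ))) := by
      simp [hI, mul_add]
    exact LinearMap.range_eq_top.2 ((LinearMap.injective_iff_surjective_of_finrank_eq_finrank hdim).1 hi)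
  have hmap := hs.map_nhds_eq_of_surj hsurj
  have hmem : Ψ '' (Set.univ ×ˢ U) ∈ nhds (Ψ (0, z)) := by
    rw [← hmap]
    exact Filter.image_mem_map (prod_mem_nhds Filter.univ_mem hU)
  have hcont : Filter.Tendsto (fun t : ℝ => ((t, ((fun _ => 0), fun j => z (j, 0))) :
      ℝ × ((I → ℝ) × (κ → ℝ)))) (nhds 0) (nhds (Ψ (0, z))) := by
    have : Ψ (0, z) = (0, ((fun _ => 0), fun j => z (j, 0))) := by
      simp [Ψ, hz]
    rw [this]
    exact (Continuous.prodMk continuous_id continuous_const).tendsto 0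
  filter_upwards [hcont hmem] with t ht
  obtain ⟨⟨t', x⟩, hx, hΨ⟩ := ht
  have h1 : t' = t := congrArg Prod.fst hΨ
  subst h1
  refine ⟨x, hx.2, fun i => ?_⟩
  have := congrFun (congrArg (fun y => y.2.1) hΨ) i
  simpa [Ψ, smul_eq_C_mul] using this

/-- the polynomial whose coefficients give the point attached to a balanced choice -/
def zpol (c : I → Tt κ) (j : κ) : Polynomial ℝ :=
  ∏ i ∈ Finset.univ.filter (fun i => (c i).1 = j), (Polynomial.X - Polynomial.C (node I κ i (c i)))

def zpt (d : ℕ) (c : I → Tt κ) : κ × Fin (d + 1) → ℝ := fun s => (zpol c s.1).coeff s.2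

lemma eval_form_zpt {c : I → Tt κ} (hc : bal d c) (j : κ) (s : ℝ) :
    eval (zpt d c) (form j s) =
      ∏ i ∈ Finset.univ.filter (fun i => (c i).1 = j), (s - node I κ i (c i)) := by
  have hdeg : (zpol c j).natDegree < d + 1 := by
    unfold zpol
    rw [Polynomial.natDegree_finsetProd_X_sub_C_eq_card]
    exact Nat.lt_succ_of_le (hc j).le
  have := Polynomial.eval_eq_sum_range' hdeg s
  rw [eval_form]
  rw [Finset.sum_range] at this
  have h2 : (zpol c j).eval s = ∏ i ∈ Finset.univ.filter (fun i => (c i).1 = j),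
      (s - node I κ i (c i)) := by
    unfold zpol; rw [Polynomial.eval_prod]; simp
  rw [← h2, this]
  refine Finset.sum_congr rfl fun l _ => ?_
  rw [mul_comm]; rfl

lemma eval_Lf_zpt_iff {c : I → Tt κ} (hc : bal d c) (i : I) (p : Tt κ) :
    eval (zpt d c) (Lf d i p) = 0 ↔ p = c i := by
  unfold Lf
  rw [eval_form_zpt hc, Finset.prod_eq_zero_iff]
  constructor
  · rintro ⟨i', _, h⟩
    obtain ⟨rfl, h2⟩ := node_inj (sub_eq_zero.1 h)
    exact h2
  · rintro rfl
    exact ⟨i, by simp, by simp⟩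

lemma eval_X_zpt {c : I → Tt κ} (hc : bal d c) (j : κ) : zpt d c (j, 0) ≠ 0 := by
  have := eval_form_zpt hc j 0
  rw [form_zero, eval_X] at this
  rw [this, Finset.prod_ne_zero_iff]
  intro i _
  simpa using node_ne i (c i)

lemma eval_Gf_line (e : I → κ → ℕ) {c : I → Tt κ} (hc : bal d c) (hcT : ∀ i, c i ∈ Tset e i) (i : I)
    (ξ : κ × Fin (d + 1) → ℝ)
    (h : HasDerivAt (fun s : ℝ => eval (zpt d c + s • ξ) (Gf d e i)) 0 0) :
    eval ξ (Lf d i (c i)) = 0 := by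
  have hlin : ∀ p (s : ℝ), eval (zpt d c + s • ξ) (Lf d i p) =
      eval (zpt d c) (Lf d i p) + s * eval ξ (Lf d i p) := by
    intro p s
    simp only [Lf, eval_form, Finset.mul_sum, ← Finset.sum_add_distrib]
    refine Finset.sum_congr rfl fun l _ => ?_
    simp; ring
  have h0 := (eval_Lf_zpt_iff hc i (c i)).2 rfl
  have hG : (fun s : ℝ => eval (zpt d c + s • ξ) (Gf d e i)) = fun s =>
      s * (eval ξ (Lf d i (c i)) * ∏ p ∈ (Tset e i).erase (c i),
        (eval (zpt d c) (Lf d i p) + s * eval ξ (Lf d i p))) := by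
    ext s
    unfold Gf
    rw [map_prod, ← Finset.mul_prod_erase _ _ (hcT i), hlin, h0, zero_add, mul_assoc]
    simp only [hlin]
  rw [hG] at h
  have hd2 : DifferentiableAt ℝ (fun s => (eval ξ (Lf d i (c i)) * ∏ p ∈ (Tset e i).erase (c i),
        (eval (zpt d c) (Lf d i p) + s * eval ξ (Lf d i p)))) (0 : ℝ) := by
    refine DifferentiableAt.const_mul ?_ _
    apply DifferentiableAt.fun_finsetProd
    intro p _
    fun_prop
  have h3 := (hasDerivAt_id (0 : ℝ)).mul hd2.hasDerivAt
  have h4 := h3.unique h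
  simp only [one_mul, zero_mul, add_zero, id] at h4
  rcases mul_eq_zero.1 h4 with h5 | h5
  · exact h5
  · exfalso
    rw [Finset.prod_eq_zero_iff] at h5
    obtain ⟨p, hp, hp0⟩ := h5
    exact (Finset.mem_erase.1 hp).1 ((eval_Lf_zpt_iff hc i p).1 hp0)

lemma zpt_inj (e : I → κ → ℕ) {c : I → Tt κ} (hc : bal d c) (hcT : ∀ i, c i ∈ Tset e i)
    (ξ : κ × Fin (d + 1) → ℝ)
    (h : ∀ i, HasDerivAt (fun s : ℝ => eval (zpt d c + s • ξ) (Gf d e i)) 0 0)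
    (h0 : ∀ j, ξ (j, 0) = 0) : ξ = 0 := by
  ext ⟨j, l⟩
  have := vand_mem (⊥ : Submodule ℝ ℝ) (fun l => ξ (j, l)) (insert 0 (Zs c j))
    (by rw [Finset.card_insert_of_notMem (zero_notMem_Zs c j), card_Zs, hc j]) (fun s hs => by
      rw [Submodule.mem_bot]
      simp only [smul_eq_mul]
      rw [← eval_form]
      rcases Finset.mem_insert.1 hs with rfl | hs
      · rw [form_zero, eval_X]; exact h0 j
      · unfold Zs at hs
        simp only [Finset.mem_image, Finset.mem_filter, Finset.mem_univ, true_and] at hs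
        obtain ⟨i, rfl, rfl⟩ := hs
        exact eval_Gf_line e hc hcT i ξ (h i)) l
  simpa using this

def Qf (d : ℕ) (e : I → κ → ℕ) (b : κ → ℕ) (c : I → Tt κ) : Rg κ d :=
  (∏ i, ∏ p ∈ (Tset e i).erase (c i), Lf d i p) *
    ∏ j, X (j, 0) ^ ((b - ∑ i, ∑ p ∈ (Tset e i).erase (c i), (Pi.single p.1 1 : κ → ℕ)) j)

lemma Qf_hom (e : I → κ → ℕ) (b : κ → ℕ) (hb : ∑ i, e i ≤ b) (c : I → Tt κ) :
    IsWeightedHomogeneous (wt κ d) (Qf d e b c) b := by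
  have h1 : IsWeightedHomogeneous (wt κ d) (∏ i, ∏ p ∈ (Tset e i).erase (c i), Lf d i p)
      (∑ i, ∑ p ∈ (Tset e i).erase (c i), (Pi.single p.1 1 : κ → ℕ)) :=
    IsWeightedHomogeneous.prod _ _ _ fun i _ => IsWeightedHomogeneous.prod _ _ _ fun p _ => Lf_hom i p
  set δ := ∑ i, ∑ p ∈ (Tset e i).erase (c i), (Pi.single p.1 1 : κ → ℕ) with hδ
  have hle : δ ≤ b := by
    refine le_trans ?_ hb
    refine Finset.sum_le_sum fun i _ => ?_
    rw [← sum_Tset e i]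
    exact Finset.sum_le_sum_of_subset (Finset.erase_subset _ _)
  have h2 : IsWeightedHomogeneous (wt κ d)
      (∏ j, (X (j, 0) : Rg κ d) ^ ((b - δ) j)) (∑ j, (b - δ) j • (Pi.single j 1 : κ → ℕ)) :=
    IsWeightedHomogeneous.prod _ _ _ fun j _ => (isWeightedHomogeneous_X ℝ (wt κ d) (j, 0)).pow _
  have h3 : ∑ j, (b - δ) j • (Pi.single j 1 : κ → ℕ) = b - δ := by
    ext j; simp [Finset.sum_apply, Pi.single_apply]
  rw [h3] at h2
  have h4 := h1.mul h2
  rw [add_tsub_cancel_of_le hle] at h4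
  exact h4

lemma Qf_self (e : I → κ → ℕ) (b : κ → ℕ) {c : I → Tt κ} (hc : bal d c) :
    eval (zpt d c) (Qf d e b c) ≠ 0 := by
  unfold Qf
  simp only [map_mul, map_prod, map_pow, eval_X]
  refine mul_ne_zero ?_ ?_
  · refine Finset.prod_ne_zero_iff.2 fun i _ => Finset.prod_ne_zero_iff.2 fun p hp h0 => ?_
    exact (Finset.mem_erase.1 hp).1 ((eval_Lf_zpt_iff hc i p).1 h0)
  · exact Finset.prod_ne_zero_iff.2 fun j _ => pow_ne_zero _ (eval_X_zpt hc j)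

lemma Qf_other (e : I → κ → ℕ) (b : κ → ℕ) {c c' : I → Tt κ} (hc : bal d c')
    (hcT : ∀ i, c' i ∈ Tset e i) (hne : c ≠ c') :
    eval (zpt d c') (Qf d e b c) = 0 := by
  obtain ⟨i, hi⟩ := Function.ne_iff.1 hne
  unfold Qf
  simp only [map_mul, map_prod]
  apply mul_eq_zero_of_left
  refine Finset.prod_eq_zero (Finset.mem_univ i) (Finset.prod_eq_zero (i := c' i) ?_ ?_)
  · exact Finset.mem_erase.2 ⟨hi.symm, hcT i⟩
  · exact (eval_Lf_zpt_iff hc i _).2 rfl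

lemma hf_ge_of_points {C : Type} [Fintype C] [DecidableEq C] (J : Ideal (Rg κ d)) (b : κ → ℕ)
    (Q : C → Rg κ d) (hQ : ∀ c, Q c ∈ Sg κ d b) (x : C → κ × Fin (d + 1) → ℝ)
    (hx : ∀ c, ∀ f ∈ J, eval (x c) f = 0)
    (hdet : (Matrix.of fun c c' => eval (x c') (Q c)).det ≠ 0) :
    Fintype.card C ≤ hf J b := by
  let q : C → Mg J b := fun c => ⟨Ideal.Quotient.mkₐ ℝ J (Q c), ⟨Q c, hQ c, rfl⟩⟩
  have hli : LinearIndependent ℝ q := by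
    rw [Fintype.linearIndependent_iff]
    intro a ha
    have h1 : ∑ c, a c • Q c ∈ J := by
      have h2 := congrArg Subtype.val ha
      rw [← Ideal.Quotient.eq_zero_iff_mem]
      rw [← Ideal.Quotient.mkₐ_eq_mk ℝ, map_sum]
      simp only [map_smul]
      simpa [q] using h2
    have h3 : Matrix.vecMul a (Matrix.of fun c c' => eval (x c') (Q c)) = 0 := by
      ext c'
      have := hx c' _ h1
      simpa [Matrix.vecMul, dotProduct, smul_eq_C_mul] using this
    have h4 := Matrix.eq_zero_of_vecMul_eq_zero hdet h3
    exact fun c => congrFun h4 c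
  exact hli.fintype_card_le_finrank

lemma lower_near (e : I → κ → ℕ) (hI : Fintype.card I = Fintype.card κ * d) (F : I → Rg κ d)
    (b : κ → ℕ) (hb : ∑ i, e i ≤ b) :
    ∀ᶠ t in nhds (0 : ℝ),
      (BC d e).card ≤ hf (Ideal.span (Set.range fun i => Gf d e i + t • F i)) b := by
  classical
  let C := BC d e
  have hbal : ∀ c : C, bal d c.1 := fun c => (Finset.mem_filter.1 c.2).2
  have hT : ∀ (c : C) i, c.1 i ∈ Tset e i := fun c =>
    Fintype.mem_piFinset.1 (Finset.mem_filter.1 c.2).1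
  let D : (C → κ × Fin (d + 1) → ℝ) → ℝ := fun x =>
    (Matrix.of fun c c' : C => eval (x c') (Qf d e b c.1)).det
  have hD : Continuous D := by
    apply Continuous.matrix_det
    refine continuous_matrix fun c c' => ?_
    exact ((contDiff_eval _).continuous).comp (continuous_apply c')
  have hD0 : D (fun c => zpt d c.1) ≠ 0 := by
    have : (Matrix.of fun c c' : C => eval (zpt d c'.1) (Qf d e b c.1)) =
        Matrix.diagonal (fun c : C => eval (zpt d c.1) (Qf d e b c.1)) := by
      ext c c'
      rw [Matrix.of_apply, Matrix.diagonal_apply]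
      split_ifs with h
      · rw [h]
      · exact Qf_other e b (hbal c') (hT c') (fun h' => h (Subtype.ext h'))
    simp only [D]
    rw [this, Matrix.det_diagonal, Finset.prod_ne_zero_iff]
    exact fun c _ => Qf_self e b (hbal c)
  obtain ⟨r, hr, hball⟩ := Metric.eventually_nhds_iff.1 (hD.continuousAt.eventually_ne hD0)
  have hev : ∀ c : C, ∀ᶠ t in nhds (0 : ℝ), ∃ x ∈ Metric.ball (zpt d c.1) r,
      ∀ i, eval x (Gf d e i + t • F i) = 0 := by
    intro c
    refine near_zero hI _ F (zpt d c.1) ?_ (zpt_inj e (hbal c) (hT c)) _ (Metric.ball_mem_nhds _ hr)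
    intro i
    unfold Gf
    rw [map_prod]
    exact Finset.prod_eq_zero (hT c i) ((eval_Lf_zpt_iff (hbal c) i _).2 rfl)
  filter_upwards [Filter.eventually_all.2 hev] with t ht
  choose x hx1 hx2 using ht
  have := hf_ge_of_points (C := C) (Ideal.span (Set.range fun i => Gf d e i + t • F i)) b
    (fun c => Qf d e b c.1) (fun c => Qf_hom e b hb c.1) x ?_ ?_
  · simpa [C] using this
  · intro c f hf
    have : Ideal.span (Set.range fun i => Gf d e i + t • F i) ≤ RingHom.ker (eval (x c)) := by
      rw [Ideal.span_le]
      rintro _ ⟨i, rfl⟩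
      exact hx2 c i
    exact this hf
  · exact hball ((dist_pi_lt_iff hr).2 fun c => hx1 c)

lemma lower_all (e : I → κ → ℕ) (hI : Fintype.card I = Fintype.card κ * d) (F : I → Rg κ d)
    (hF : ∀ i, IsWeightedHomogeneous (wt κ d) (F i) (e i))
    (b : κ → ℕ) (hb : ∑ i, e i ≤ b) (t : ℝ) :
      (BC d e).card ≤ hf (Ideal.span (Set.range fun i => Gf d e i + t • F i)) b := by
  by_contra hlt
  push Not at hlt
  have h1 := semi (Gf_hom (d := d) e) hF b ((BC d e).card - 1) t (by omega)
  have h2 := lower_near e hI F b hb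
  obtain ⟨r, hr, hball⟩ := Metric.eventually_nhds_iff.1 h2
  have h3 : (Metric.ball (0 : ℝ) r).Finite := by
    refine h1.subset ?_
    intro s hs
    have := hball hs
    simp only [Set.mem_ofPred_eq]
    omega
  have h4 : (Metric.ball (0 : ℝ) r).Infinite := by
    rw [Real.ball_eq_Ioo]
    exact Set.Ioo_infinite (by linarith)
  exact h4 h3

end BU

end part_PE

section part_PF
open MvPolynomial Module

set_option linter.unusedSectionVars false
set_option linter.style.haveILetI false
namespace BU

variable {κ : Type} [Fintype κ] [DecidableEq κ] {d : ℕ}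

lemma odd_root (p : Polynomial ℝ) (hm : p.Monic) (hodd : Odd p.natDegree) : ∃ x, p.eval x = 0 := by
  have hdeg : 0 < p.degree := Polynomial.natDegree_pos_iff_degree_pos.1 hodd.pos
  have h1 : ∃ x, 0 ≤ p.eval x :=
    ((Polynomial.tendsto_atTop_of_leadingCoeff_nonneg p hdeg
      (by rw [hm.leadingCoeff]; norm_num)).eventually_ge_atTop 0).exists
  have h2 : ∃ x, p.eval x ≤ 0 := by
    let r : Polynomial ℝ := -(p.comp (-Polynomial.X))
    have hnd : r.natDegree = p.natDegree := by
      simp [r, Polynomial.natDegree_comp]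
    have hlc : r.leadingCoeff = 1 := by
      simp only [r, Polynomial.leadingCoeff_neg]
      rw [Polynomial.leadingCoeff_comp (by simp)]
      simp [hm.leadingCoeff, hodd.neg_one_pow]
    have := ((Polynomial.tendsto_atTop_of_leadingCoeff_nonneg r
      (Polynomial.natDegree_pos_iff_degree_pos.1 (hnd ▸ hodd.pos))
      (by rw [hlc]; norm_num)).eventually_ge_atTop 0).exists
    obtain ⟨x, hx⟩ := this
    refine ⟨-x, ?_⟩
    simp [r] at hx
    exact hx
  obtain ⟨a, ha⟩ := h1
  obtain ⟨b, hb⟩ := h2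
  exact mem_range_of_exists_le_of_exists_ge p.continuous ⟨b, hb⟩ ⟨a, ha⟩

lemma odd_eigen {V : Type*} [AddCommGroup V] [Module ℝ V] [Module.Finite ℝ V] (T : V →ₗ[ℝ] V)
    (h : Odd (finrank ℝ V)) : ∃ (r : ℝ) (v : V), v ≠ 0 ∧ T v = r • v := by
  obtain ⟨r, hr⟩ := odd_root T.charpoly T.charpoly_monic (by rwa [LinearMap.charpoly_natDegree])
  have : Module.End.HasEigenvalue T r := by
    rw [Module.End.hasEigenvalue_iff_isRoot_charpoly]
    exact hr
  obtain ⟨v, hv⟩ := this.exists_hasEigenvector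
  exact ⟨r, v, hv.2, hv.apply_eq_smul⟩

lemma common_eigen {V ι : Type*} [AddCommGroup V] [Module ℝ V] [Module.Finite ℝ V]
    (T : ι → V →ₗ[ℝ] V) (hc : ∀ i j v, T i (T j v) = T j (T i v)) (n : ℕ) :
    ∀ W : Submodule ℝ V, finrank ℝ W = n → Odd n → (∀ i, ∀ v ∈ W, T i v ∈ W) →
      ∃ v ∈ W, v ≠ 0 ∧ ∀ i, ∃ r : ℝ, T i v = r • v := by
  induction n using Nat.strong_induction_on with
  | _ n ih =>
    intro W hW hn hinv
    by_cases hall : ∀ i, ∃ r : ℝ, ∀ v ∈ W, T i v = r • v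
    · have : W ≠ ⊥ := by
        rintro rfl
        simp at hW
        subst hW
        simp at hn
      obtain ⟨v, hv, hv0⟩ := Submodule.exists_mem_ne_zero_of_ne_bot this
      exact ⟨v, hv, hv0, fun i => (hall i).imp fun r hr => hr v hv⟩
    · push Not at hall
      obtain ⟨i, hi⟩ := hall
      obtain ⟨r, v, hv0, hv⟩ := odd_eigen ((T i).restrict (hinv i)) (by rwa [hW])
      let f : V →ₗ[ℝ] V := T i - r • LinearMap.id
      have hf : ∀ w, f w = T i w - r • w := fun w => rfl
      have hfc : ∀ j w, f (T j w) = T j (f w) := by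
        intro j w
        rw [hf, hf, map_sub, map_smul, hc]
      have hsum := finrank_map_add W f
      have hfin1 : Module.Finite ℝ (W ⊓ LinearMap.ker f : Submodule ℝ V) := inferInstance
      have hK : 0 < finrank ℝ (W ⊓ LinearMap.ker f : Submodule ℝ V) := by
        rw [Module.finrank_pos_iff]
        refine ⟨⟨⟨v.1, v.2, ?_⟩, 0, ?_⟩⟩
        · rw [SetLike.mem_coe, LinearMap.mem_ker, hf]
          have := congrArg Subtype.val hv
          simp only [LinearMap.coe_restrict_apply] at this
          rw [this]; simp
        · intro h
          have h' : (v : V) = 0 := congrArg Subtype.val h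
          exact hv0 (Subtype.ext h')
      have hR : 0 < finrank ℝ (W.map f) := by
        rw [Module.finrank_pos_iff]
        obtain ⟨w, hw, hne⟩ := hi r
        refine ⟨⟨⟨f w, w, hw, rfl⟩, 0, ?_⟩⟩
        intro h
        have := congrArg Subtype.val h
        apply hne
        rw [← sub_eq_zero]
        exact this
      rcases Nat.even_or_odd (finrank ℝ (W.map f)) with he | ho
      · have ho : Odd (finrank ℝ (W ⊓ LinearMap.ker f : Submodule ℝ V)) := by
          rw [hW] at hsum
          rw [← hsum] at hn
          exact (Nat.odd_add'.1 hn).2 he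
        obtain ⟨u, hu, h⟩ := ih _ (by omega) (W ⊓ LinearMap.ker f) rfl ho (by
          intro j u hu
          refine ⟨hinv j u hu.1, ?_⟩
          have := hu.2
          rw [SetLike.mem_coe, LinearMap.mem_ker] at this ⊢
          rw [hfc, this, map_zero])
        exact ⟨u, hu.1, h⟩
      · obtain ⟨u, hu, h⟩ := ih _ (by omega) (W.map f) rfl ho (by
          rintro j _ ⟨w, hw, rfl⟩
          exact ⟨T j w, hinv j w hw, hfc j w⟩)
        refine ⟨u, ?_, h⟩
        obtain ⟨w, hw, rfl⟩ := hu
        rw [hf]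
        exact Submodule.sub_mem _ (hinv i w hw) (Submodule.smul_mem _ _ hw)

lemma mul_mem_Mg {J : Ideal (Rg κ d)} {f : Rg κ d} {δ b : κ → ℕ}
    (hf : IsWeightedHomogeneous (wt κ d) f δ) {y : Rg κ d ⧸ J} (hy : y ∈ Mg J b) :
    Ideal.Quotient.mk J f * y ∈ Mg J (b + δ) := by
  obtain ⟨g, hg, rfl⟩ := hy
  refine ⟨f * g, ?_, by simp⟩
  have := hf.mul hg
  rwa [add_comm δ b] at this

/-- multiplication by a homogeneous element -/
def mulM (J : Ideal (Rg κ d)) (f : Rg κ d) {δ : κ → ℕ} (hf : IsWeightedHomogeneous (wt κ d) f δ)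
    (b : κ → ℕ) : Mg J b →ₗ[ℝ] Mg J (b + δ) :=
  (LinearMap.mulLeft ℝ (Ideal.Quotient.mk J f)).restrict (fun _ hy => mul_mem_Mg hf hy)

lemma mulM_coe (J : Ideal (Rg κ d)) (f : Rg κ d) {δ : κ → ℕ}
    (hf : IsWeightedHomogeneous (wt κ d) f δ) (b : κ → ℕ) (y : Mg J b) :
    (mulM J f hf b y : Rg κ d ⧸ J) = Ideal.Quotient.mk J f * y := rfl

lemma X_hom (s : κ × Fin (d + 1)) :
    IsWeightedHomogeneous (wt κ d) (X s : Rg κ d) (Pi.single s.1 1) :=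
  isWeightedHomogeneous_X ℝ _ s

lemma mulM_surj {A : Set (Rg κ d)} (hA : ∀ g ∈ A, ∃ δ, IsWeightedHomogeneous (wt κ d) g δ)
    (j : κ) (b : κ → ℕ) (h0 : hf (Ideal.span ({X (j, 0)} ∪ A)) (b + Pi.single j 1) = 0) :
    Function.Surjective (mulM (Ideal.span A) (X (j, 0)) (X_hom (j, 0)) b) := by
  classical
  rintro ⟨_, g, hg, rfl⟩
  have hg2 : g ∈ Ideal.span ({X (j, 0)} ∪ A) := by
    unfold hf at h0
    rw [Submodule.finrank_eq_zero] at h0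
    have : Ideal.Quotient.mk (Ideal.span ({X (j, 0)} ∪ A)) g ∈
        Mg (Ideal.span ({X (j, 0)} ∪ A)) (b + Pi.single j 1) := ⟨g, hg, rfl⟩
    rw [h0, Submodule.mem_bot] at this
    rwa [Ideal.Quotient.eq_zero_iff_mem] at this
  rw [Set.singleton_union, Ideal.mem_span_insert] at hg2
  obtain ⟨r, z, hz, hgz⟩ := hg2
  have h1 := IsWeightedHomogeneous.weightedHomogeneousComponent_same hg
  have h2 := isHom_span hA z hz (b + Pi.single j 1)
  rw [hgz, map_add, comp_mul (X_hom (j, 0)), if_pos (by simp)] at h1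
  rw [show b + Pi.single j 1 - Pi.single (j, (0 : Fin (d + 1))).1 1 = b by simp] at h1
  refine ⟨⟨Ideal.Quotient.mk _ (weightedHomogeneousComponent (wt κ d) b r),
    weightedHomogeneousComponent (wt κ d) b r,
    weightedHomogeneousComponent_isWeightedHomogeneous b r, rfl⟩, ?_⟩
  apply Subtype.ext
  rw [mulM_coe]
  simp only [AlgHom.toLinearMap_apply, Ideal.Quotient.mkₐ_eq_mk]
  rw [← map_mul, Ideal.Quotient.eq, hgz, ← h1, mul_comm, sub_add_eq_sub_sub, sub_self, zero_sub]
  exact neg_mem h2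

variable {I : Type} [Fintype I] [DecidableEq I]

lemma alg_exists (P : I → Rg κ d) (e : I → κ → ℕ)
    (hP : ∀ i, IsWeightedHomogeneous (wt κ d) (P i) (e i)) (n : ℕ) (hn : Odd n) (b0 b1 : κ → ℕ)
    (hb2 : ∀ j j', b0 + Pi.single j 1 + Pi.single j' 1 ≤ b1) (hbe : ∀ i, b0 + e i ≤ b1)
    (h1 : ∀ b, b0 ≤ b → b ≤ b1 → hf (Ideal.span (Set.range P)) b = n)
    (h2 : ∀ b j, b0 ≤ b → b ≤ b1 → hf (Ideal.span ({X (j, 0)} ∪ Set.range P)) b = 0)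
    (hI : Nonempty I) :
    ∃ x : κ × Fin (d + 1) → ℝ, (∀ i, eval x (P i) = 0) ∧ ∀ j, x (j, 0) = 1 := by
  classical
  set J := Ideal.span (Set.range P) with hJ
  have hA : ∀ g ∈ Set.range P, ∃ δ, IsWeightedHomogeneous (wt κ d) g δ := by
    rintro _ ⟨i, rfl⟩; exact ⟨_, hP i⟩
  have hbij : ∀ j b, b0 ≤ b → b + Pi.single j 1 ≤ b1 →
      Function.Bijective (mulM J (X (j, 0)) (X_hom (j, 0)) b) := by
    intro j b hb hb'
    have hle : b ≤ b + Pi.single j 1 := le_self_add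
    have hs := mulM_surj hA j b (h2 _ j (hb.trans hle) hb')
    refine ⟨?_, hs⟩
    refine (LinearMap.injective_iff_surjective_of_finrank_eq_finrank ?_).2 hs
    have e1 := h1 b hb (hle.trans hb')
    have e2 := h1 _ (hb.trans hle) hb'
    exact e1.trans e2.symm
  have hinj : ∀ j b, b0 ≤ b → b + Pi.single j 1 ≤ b1 → ∀ y ∈ Mg J b,
      Ideal.Quotient.mk J (X (j, 0)) * y = 0 → y = 0 := by
    intro j b hb hb' y hy h
    have := (hbij j b hb hb').1 (a₁ := ⟨y, hy⟩) (a₂ := 0) (by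
      apply Subtype.ext; rw [mulM_coe, h]; simp)
    exact congrArg Subtype.val this
  have hb1 : ∀ j, b0 + Pi.single j 1 ≤ b1 := fun j => le_self_add.trans (hb2 j j)
  let L : ∀ j, Mg J b0 ≃ₗ[ℝ] Mg J (b0 + Pi.single j 1) := fun j =>
    LinearEquiv.ofBijective _ (hbij j b0 le_rfl (hb1 j))
  let T : κ × Fin (d + 1) → Mg J b0 →ₗ[ℝ] Mg J b0 := fun s =>
    (L s.1).symm.toLinearMap ∘ₗ mulM J (X s) (X_hom s) b0
  have hT : ∀ s v, Ideal.Quotient.mk J (X (s.1, 0)) * (T s v : Rg κ d ⧸ J) =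
      Ideal.Quotient.mk J (X s) * v := by
    intro s v
    have : L s.1 (T s v) = mulM J (X s) (X_hom s) b0 v := by simp [T]
    exact congrArg Subtype.val this
  have hcomm : ∀ s s' v, T s (T s' v) = T s' (T s v) := by
    intro s s' v
    apply Subtype.ext
    rw [← sub_eq_zero]
    refine hinj s.1 b0 le_rfl (hb1 _) _ (Submodule.sub_mem _ (T s (T s' v)).2 (T s' (T s v)).2) ?_
    refine hinj s'.1 _ le_self_add (hb2 s.1 s'.1) _ (mul_mem_Mg (X_hom (s.1, 0))
      (Submodule.sub_mem _ (T s (T s' v)).2 (T s' (T s v)).2)) ?_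
    have e1 := hT s (T s' v)
    have e2 := hT s' v
    have e3 := hT s' (T s v)
    have e4 := hT s v
    linear_combination (Ideal.Quotient.mk J (X (s'.1, 0))) * e1 +
      (Ideal.Quotient.mk J (X s)) * e2 - (Ideal.Quotient.mk J (X (s.1, 0))) * e3 -
      (Ideal.Quotient.mk J (X s')) * e4
  have hfr : finrank ℝ (⊤ : Submodule ℝ (Mg J b0)) = n := by
    rw [finrank_top]
    exact h1 b0 le_rfl (le_self_add.trans (hbe hI.some))
  obtain ⟨v, -, hv0, hv⟩ := common_eigen T hcomm n ⊤ hfr hn (fun _ _ _ => trivial)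
  choose lam hlam using hv
  have hv0' : (v : Rg κ d ⧸ J) ≠ 0 := fun h => hv0 (Subtype.ext h)
  have hX : ∀ s, Ideal.Quotient.mk J (X s) * (v : Rg κ d ⧸ J) =
      lam s • (Ideal.Quotient.mk J (X (s.1, 0)) * v) := by
    intro s
    rw [← hT s v, hlam s, Submodule.coe_smul, mul_smul_comm]
  have hpow : ∀ N : ℕ, ∀ a : κ → ℕ, ∑ j, a j = N → b0 + a ≤ b1 →
      (∏ j, Ideal.Quotient.mk J (X (j, 0)) ^ a j) * (v : Rg κ d ⧸ J) ∈ Mg J (b0 + a) ∧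
      (∏ j, Ideal.Quotient.mk J (X (j, 0)) ^ a j) * (v : Rg κ d ⧸ J) ≠ 0 := by
    intro N
    induction N with
    | zero =>
      intro a ha _
      have : a = 0 := by
        ext j
        exact (Finset.sum_eq_zero_iff.1 ha) j (Finset.mem_univ j)
      subst this
      simpa using hv0
    | succ N ih =>
      intro a ha hab
      have : ∃ j, 0 < a j := by
        by_contra hcon
        push Not at hcon
        have : ∑ j, a j = 0 := Finset.sum_eq_zero fun j _ => Nat.le_zero.1 (hcon j)
        omega
      obtain ⟨j, hj⟩ := this
      obtain ⟨a', rfl⟩ : ∃ a', a = a' + (Pi.single j 1 : κ → ℕ) := by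
        refine ⟨a - Pi.single j 1, ?_⟩
        ext k
        by_cases hk : k = j
        · subst hk; simp; omega
        · simp [hk]
      have ha' : ∑ k, a' k = N := by
        simp only [Pi.add_apply, Finset.sum_add_distrib] at ha
        simp at ha
        exact ha
      rw [← add_assoc] at hab
      obtain ⟨i1, i2⟩ := ih a' ha' (le_self_add.trans hab)
      have hprod : (∏ k, Ideal.Quotient.mk J (X (k, 0)) ^ (a' + (Pi.single j 1 : κ → ℕ)) k) =
          Ideal.Quotient.mk J (X (j, 0)) * ∏ k, Ideal.Quotient.mk J (X (k, 0)) ^ a' k := by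
        simp only [Pi.add_apply, pow_add, Finset.prod_mul_distrib]
        rw [mul_comm]
        congr 1
        rw [Finset.prod_eq_single j]
        · simp
        · intro k _ hk; simp [hk]
        · simp
      rw [hprod, mul_assoc, ← add_assoc]
      refine ⟨mul_mem_Mg (X_hom (j, 0)) i1, fun h0 => i2 ?_⟩
      exact hinj j _ le_self_add hab _ i1 h0
  let K : Ideal (Rg κ d ⧸ J) := LinearMap.ker (LinearMap.toSpanSingleton (Rg κ d ⧸ J) _ (v : Rg κ d ⧸ J))
  have hK : ∀ y, y ∈ K ↔ y * (v : Rg κ d ⧸ J) = 0 := by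
    intro y; simp [K, LinearMap.mem_ker]
  refine ⟨lam, ?_, ?_⟩
  · intro i
    have h := algHom_hom ((Ideal.Quotient.mkₐ ℝ K).comp (Ideal.Quotient.mkₐ ℝ J)) lam
      (fun j => Ideal.Quotient.mk K (Ideal.Quotient.mk J (X (j, 0)))) ?_ (hP i)
    · have h3 : Ideal.Quotient.mk J (P i) = 0 :=
        Ideal.Quotient.eq_zero_iff_mem.2 (Ideal.subset_span ⟨i, rfl⟩)
      simp only [AlgHom.comp_apply, Ideal.Quotient.mkₐ_eq_mk, h3, map_zero] at h
      have h4 : eval lam (P i) • ∏ j, Ideal.Quotient.mk J (X (j, 0)) ^ e i j ∈ K := by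
        rw [← Ideal.Quotient.eq_zero_iff_mem, ← Ideal.Quotient.mkₐ_eq_mk ℝ, map_smul,
          Ideal.Quotient.mkₐ_eq_mk, map_prod]
        simp only [map_pow]
        exact h.symm
      rw [hK, smul_mul_assoc] at h4
      by_contra hne
      exact (hpow _ (e i) rfl (hbe i)).2 ((smul_eq_zero_iff_right hne).1 h4)
    · intro s
      simp only [AlgHom.comp_apply, Ideal.Quotient.mkₐ_eq_mk]
      rw [← Ideal.Quotient.mkₐ_eq_mk ℝ K, ← map_smul, Ideal.Quotient.mkₐ_eq_mk, Ideal.Quotient.eq,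
        hK, sub_mul, hX s, smul_mul_assoc, sub_self]
  · intro j
    have h := hX (j, 0)
    by_contra hne
    have h5 : (1 - lam (j, 0)) • (Ideal.Quotient.mk J (X (j, 0)) * (v : Rg κ d ⧸ J)) = 0 := by
      rw [sub_smul, one_smul, ← h, sub_self]
    rcases smul_eq_zero.1 h5 with h6 | h6
    · exact hne (by linarith)
    · exact hv0' (hinj j b0 le_rfl (hb1 j) _ v.2 h6)

/-- product of unit spheres -/
def KS (κ : Type) (d : ℕ) : Set (κ × Fin (d + 1) → ℝ) := {x | ∀ j, ∑ l, x (j, l) ^ 2 = 1}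

lemma alg_generic (e : I → κ → ℕ) (hI : Fintype.card I = Fintype.card κ * d) (hIn : Nonempty I)
    (hodd : Odd (BC d e).card) (F : I → Rg κ d)
    (hF : ∀ i, IsWeightedHomogeneous (wt κ d) (F i) (e i)) :
    {t : ℝ | ¬ ∃ x ∈ KS κ d, ∀ i, eval x (Gf d e i + t • F i) = 0}.Finite := by
  classical
  have hne : (BC d e).Nonempty := Finset.card_pos.1 hodd.pos
  obtain ⟨B0, hB0⟩ := up1 e hI hne
  have hu2 := fun j => up2 e hI hne j
  choose B1 hB1 using hu2
  let B : κ → ℕ := B0 + ∑ j, B1 j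
  let b0 : κ → ℕ := B + ∑ i, e i
  let b1 : κ → ℕ := b0 + ((fun _ => 2) + ∑ i, e i)
  have hfin1 : ∀ b ∈ Finset.Icc b0 b1,
      {t : ℝ | ¬ hf (Ideal.span (Set.range fun i => Gf d e i + t • F i)) b ≤ (BC d e).card}.Finite := by
    intro b hb
    rw [Finset.mem_Icc] at hb
    refine semi (Gf_hom (d := d) e) hF b _ 0 ?_
    have := hB0 b (le_trans (le_trans le_self_add le_self_add) hb.1)
    simpa using this
  have hfin2 : ∀ j, ∀ b ∈ Finset.Icc b0 b1,
      {t : ℝ | ¬ hf (Ideal.span ({X (j, 0)} ∪ Set.range fun i => Gf d e i + t • F i)) b ≤ 0}.Finite := by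
    intro j b hb
    rw [Finset.mem_Icc] at hb
    have hrange : ∀ t : ℝ, (Set.range fun o : Option I =>
        (Option.elim o (X (j, 0)) (Gf d e) : Rg κ d) + t • (Option.elim o 0 F : Rg κ d)) =
        {X (j, 0)} ∪ Set.range fun i => Gf d e i + t • F i := by
      intro t
      ext y
      simp [Set.mem_range, Option.exists, eq_comm]
    have := semi (A := fun o : Option I => (Option.elim o (X (j, 0)) (Gf d e) : Rg κ d))
      (A' := fun o => (Option.elim o 0 F : Rg κ d)) (ε := fun o => Option.elim o (Pi.single j 1) e)
      (by rintro (_ | i)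
          · exact X_hom (j, 0)
          · exact Gf_hom e i)
      (by rintro (_ | i)
          · exact Submodule.zero_mem (Sg κ d (Pi.single j 1))
          · exact hF i) b 0 0 (by
        rw [hrange]
        have := hB1 j b (by
          have h2 : B1 j ≤ ∑ j, B1 j :=
            Finset.single_le_sum (f := B1) (fun _ _ => zero_le) (Finset.mem_univ j)
          exact h2.trans (le_trans (le_trans le_add_self le_self_add) hb.1))
        simpa using this)
    simp only [hrange] at this
    exact this
  have hbig := ((Finset.Icc b0 b1).finite_toSet.biUnion hfin1).union
    (Set.finite_iUnion fun j => (Finset.Icc b0 b1).finite_toSet.biUnion (hfin2 j))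
  refine hbig.subset ?_
  intro t ht
  by_contra hcon
  apply ht
  clear ht
  simp only [Set.mem_union, Set.mem_iUnion, Set.mem_ofPred_eq, not_or, not_exists, not_not,
    Finset.mem_coe, Finset.mem_Icc] at hcon
  obtain ⟨hc1, hc2⟩ := hcon
  have hei : ∀ i, e i ≤ ∑ i, e i := fun i =>
    Finset.single_le_sum (f := e) (fun _ _ => zero_le) (Finset.mem_univ i)
  have hP : ∀ i, IsWeightedHomogeneous (wt κ d) (Gf d e i + t • F i) (e i) := fun i =>
    (Gf_hom e i).add (Submodule.smul_mem (Sg κ d (e i)) t (hF i))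
  obtain ⟨x, hx, hx1⟩ := alg_exists (fun i => Gf d e i + t • F i) e
    hP (BC d e).card hodd b0 b1 (by
      intro j j'
      simp only [b1]
      rw [add_assoc]
      refine add_le_add le_rfl (le_trans ?_ le_self_add)
      intro k
      simp only [Pi.add_apply, Pi.single_apply]
      split_ifs <;> omega)
    (by
      intro i
      simp only [b1]
      exact add_le_add le_rfl ((hei i).trans le_add_self))
    (fun b hb hb' => le_antisymm (hc1 b ⟨hb, hb'⟩) (lower_all e hI F hF b (by
      refine le_trans ?_ hb
      exact le_add_self) t))
    (fun b j hb hb' => Nat.le_zero.1 (hc2 j b ⟨hb, hb'⟩)) hIn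
  let nrm : κ → ℝ := fun j => Real.sqrt (∑ l, x (j, l) ^ 2)
  have hpos : ∀ j, 0 < ∑ l, x (j, l) ^ 2 := by
    intro j
    have : x (j, 0) ^ 2 ≤ ∑ l, x (j, l) ^ 2 :=
      Finset.single_le_sum (f := fun l => x (j, l) ^ 2) (fun _ _ => sq_nonneg _) (Finset.mem_univ 0)
    rw [hx1 j] at this
    linarith
  refine ⟨fun s => x s * (nrm s.1)⁻¹, ?_, ?_⟩
  · intro j
    simp only [mul_pow, ← Finset.sum_mul, nrm, inv_pow]
    rw [Real.sq_sqrt (hpos j).le]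
    exact mul_inv_cancel₀ (hpos j).ne'
  · intro i
    have := hom_eval (A := ℝ) x (fun j => (nrm j)⁻¹) (hP i)
    rw [hx i, zero_smul] at this
    rw [← this, MvPolynomial.aeval_eq_eval]
    rfl

end BU

end part_PF

section part_PG
open MvPolynomial Module

set_option linter.unusedSectionVars false
set_option linter.style.haveILetI false
namespace BU

variable {κ : Type} [Fintype κ] [DecidableEq κ] {d : ℕ}

lemma isCompact_KS : IsCompact (KS κ d) := by
  rw [Metric.isCompact_iff_isClosed_bounded]
  constructor
  · have : KS κ d = ⋂ j, {x | ∑ l, x (j, l) ^ 2 = 1} := by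
      ext x; simp [KS]
    rw [this]
    refine isClosed_iInter fun j => isClosed_eq ?_ continuous_const
    fun_prop
  · rw [isBounded_iff_forall_norm_le]
    refine ⟨1, fun x hx => ?_⟩
    rw [pi_norm_le_iff_of_nonneg zero_le_one]
    rintro ⟨j, l⟩
    have h1 : x (j, l) ^ 2 ≤ ∑ l, x (j, l) ^ 2 :=
      Finset.single_le_sum (f := fun l => x (j, l) ^ 2) (fun _ _ => sq_nonneg _) (Finset.mem_univ l)
    rw [hx j] at h1
    rw [Real.norm_eq_abs]
    exact (sq_le_one_iff_abs_le_one _).1 h1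

lemma stone (f : (κ × Fin (d + 1) → ℝ) → ℝ) (hf : ContinuousOn f (KS κ d)) (ε : ℝ) (hε : 0 < ε) :
    ∃ p : Rg κ d, ∀ x ∈ KS κ d, |eval x p - f x| < ε := by
  have hcs : CompactSpace (KS κ d) := isCompact_iff_compactSpace.1 isCompact_KS
  let co : κ × Fin (d + 1) → C(KS κ d, ℝ) := fun s => ⟨fun x => x.1 s, (continuous_apply s).comp continuous_subtype_val⟩
  let Φ : Rg κ d →ₐ[ℝ] C(KS κ d, ℝ) := aeval co
  have hΦ : ∀ p x, Φ p x = eval x.1 p := by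
    intro p x
    induction p using MvPolynomial.induction_on with
    | C a => simp [Φ]
    | add p q hp hq => simp [hp, hq]
    | mul_X p s hp => simp [hp, Φ, co]
  have hsep : Φ.range.SeparatesPoints := by
    intro x y hxy
    have : x.1 ≠ y.1 := fun h => hxy (Subtype.ext h)
    obtain ⟨s, hs⟩ := Function.ne_iff.1 this
    refine ⟨co s, ⟨co s, ⟨X s, by simp [Φ]⟩, rfl⟩, hs⟩
  obtain ⟨⟨g, p, hp⟩, hg⟩ := ContinuousMap.exists_mem_subalgebra_near_continuous_of_separatesPoints
    Φ.range hsep (fun x => f x.1) (continuousOn_iff_continuous_domRestrict.1 hf) ε hε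
  refine ⟨p, fun x hx => ?_⟩
  have := hg ⟨x, hx⟩
  rw [← hΦ p ⟨x, hx⟩]
  rw [Real.norm_eq_abs] at this
  convert this using 3
  exact congrArg (fun h : C(KS κ d, ℝ) => h ⟨x, hx⟩) hp

/-- the action of a sign vector -/
def act (g : κ → ℤˣ) (x : κ × Fin (d + 1) → ℝ) : κ × Fin (d + 1) → ℝ :=
  fun s => x s * ((g s.1 : ℤ) : ℝ)

/-- the sign character -/
def chr (χ : κ → ℕ) (g : κ → ℤˣ) : ℝ := ∏ j, ((g j : ℤ) : ℝ) ^ χ j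

lemma act_mem (g : κ → ℤˣ) {x : κ × Fin (d + 1) → ℝ} (hx : x ∈ KS κ d) : act g x ∈ KS κ d := by
  intro j
  rw [← hx j]
  refine Finset.sum_congr rfl fun l _ => ?_
  have h : (((g j : ℤ) : ℝ)) ^ 2 = 1 := by
    rcases Int.units_eq_one_or (g j) with h | h <;> simp [h]
  simp [act, mul_pow, h]

lemma abs_chr (χ : κ → ℕ) (g : κ → ℤˣ) : |chr χ g| = 1 := by
  unfold chr
  rw [Finset.abs_prod]
  refine Finset.prod_eq_one fun j _ => ?_
  rcases Int.units_eq_one_or (g j) with h | h <;> simp [h]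

lemma sum_chr (χ a : κ → ℕ) : ∑ g, chr χ g * chr a g =
    if ∀ j, a j ≡ χ j [MOD 2] then (Fintype.card (κ → ℤˣ) : ℝ) else 0 := by
  have h1 : ∑ g, chr χ g * chr a g = ∏ j : κ, ∑ u : ℤˣ, ((u : ℤ) : ℝ) ^ (χ j + a j) := by
    rw [Finset.prod_univ_sum, Fintype.piFinset_univ]
    refine Finset.sum_congr rfl fun g _ => ?_
    simp only [chr, ← Finset.prod_mul_distrib, pow_add]
  have h2 : ∀ n : ℕ, ∑ u : ℤˣ, ((u : ℤ) : ℝ) ^ n = 1 + (-1) ^ n := by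
    intro n
    have : (Finset.univ : Finset ℤˣ) = {1, -1} := by decide
    rw [this, Finset.sum_pair (by decide)]
    simp
  rw [h1]
  simp only [h2]
  split_ifs with h
  · have : ∀ j, (1 : ℝ) + (-1) ^ (χ j + a j) = 2 := by
      intro j
      have he : Even (χ j + a j) := by
        have := h j
        unfold Nat.ModEq at this
        rw [Nat.even_iff]; omega
      rw [he.neg_one_pow]; norm_num
    simp only [this]
    have hc : Fintype.card ℤˣ = 2 := by decide
    simp [Fintype.card_pi, hc]
  · push Not at h
    obtain ⟨j, hj⟩ := h
    refine Finset.prod_eq_zero (Finset.mem_univ j) ?_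
    have ho : Odd (χ j + a j) := by
      unfold Nat.ModEq at hj
      rw [Nat.odd_iff]; omega
    rw [ho.neg_one_pow]; norm_num

/-- square norm of a group -/
def Nf (j : κ) : Rg κ d := ∑ l, X (j, l) ^ 2

lemma Nf_hom (j : κ) : IsWeightedHomogeneous (wt κ d) (Nf j : Rg κ d) (2 • Pi.single j 1) := by
  rw [← mem_weightedHomogeneousSubmodule]
  exact Submodule.sum_mem _ fun l _ => (X_hom (j, l)).pow 2

lemma approx (f : (κ × Fin (d + 1) → ℝ) → ℝ) (hf : ContinuousOn f (KS κ d)) (χ : κ → ℕ)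
    (hχ : ∀ x ∈ KS κ d, ∀ g, f (act g x) = chr χ g * f x) (ε : ℝ) (hε : 0 < ε) :
    ∃ (e : κ → ℕ) (F : Rg κ d), (∀ j, e j ≡ χ j [MOD 2]) ∧ IsWeightedHomogeneous (wt κ d) F e ∧
      ∀ x ∈ KS κ d, |eval x F - f x| ≤ ε := by
  classical
  obtain ⟨p, hp⟩ := stone f hf ε hε
  let dg : (κ × Fin (d + 1) →₀ ℕ) → κ → ℕ := fun m => Finsupp.weight (wt κ d) m
  let e : κ → ℕ := fun j => χ j + 2 * ∑ m ∈ p.support, dg m j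
  let S := p.support.filter (fun m => ∀ j, dg m j ≡ χ j [MOD 2])
  let F : Rg κ d := ∑ m ∈ S, monomial m (coeff m p) * ∏ j, Nf j ^ ((e j - dg m j) / 2)
  have hmon : ∀ m c, IsWeightedHomogeneous (wt κ d) (monomial m c : Rg κ d) (dg m) := fun m c =>
    isWeightedHomogeneous_monomial _ _ _ rfl
  refine ⟨e, F, ?_, ?_, ?_⟩
  · intro j
    simp only [e, Nat.ModEq]; omega
  · rw [← mem_weightedHomogeneousSubmodule]
    refine Submodule.sum_mem _ fun m hm => ?_
    have hm' := Finset.mem_filter.1 hm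
    have h1 : IsWeightedHomogeneous (wt κ d) (∏ j, (Nf j : Rg κ d) ^ ((e j - dg m j) / 2))
        (∑ j, ((e j - dg m j) / 2) • (2 • (Pi.single j 1 : κ → ℕ))) :=
      IsWeightedHomogeneous.prod _ _ _ fun j _ => (Nf_hom j).pow _
    have h2 := (hmon m (coeff m p)).mul h1
    have h3 : dg m + ∑ j, ((e j - dg m j) / 2) • (2 • (Pi.single j 1 : κ → ℕ)) = e := by
      ext j
      have h4 : (∑ j, ((e j - dg m j) / 2) • (2 • (Pi.single j 1 : κ → ℕ))) j =
          (e j - dg m j) / 2 * 2 := by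
        simp [Finset.sum_apply, Pi.single_apply]
      rw [Pi.add_apply, h4]
      have h5 := hm'.2 j
      have h6 : dg m j ≤ ∑ m ∈ p.support, dg m j :=
        Finset.single_le_sum (f := fun m => dg m j) (fun _ _ => Nat.zero_le _) hm'.1
      simp only [e, Nat.ModEq] at h5 ⊢
      omega
    rw [h3] at h2
    exact h2
  · intro x hx
    have hF : eval x F = ∑ m ∈ S, eval x (monomial m (coeff m p)) := by
      simp only [F, map_sum, map_mul, map_prod, map_pow]
      refine Finset.sum_congr rfl fun m _ => ?_
      have : ∀ j, eval x (Nf j : Rg κ d) = 1 := by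
        intro j
        simp only [Nf, map_sum, map_pow, eval_X]
        exact hx j
      simp [this]
    have hpg : ∀ g, eval (act g x) p = ∑ m ∈ p.support, eval x (monomial m (coeff m p)) * chr (dg m) g := by
      intro g
      conv_lhs => rw [p.as_sum]
      rw [map_sum]
      refine Finset.sum_congr rfl fun m _ => ?_
      have := hom_eval (A := ℝ) x (fun j => ((g j : ℤ) : ℝ)) (hmon m (coeff m p))
      rw [MvPolynomial.aeval_eq_eval] at this
      exact this
    set c : ℝ := (Fintype.card (κ → ℤˣ) : ℝ) with hc
    have hc0 : 0 < c := by rw [hc]; exact_mod_cast Fintype.card_pos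
    have key : c * (eval x F - f x) = ∑ g, chr χ g * (eval (act g x) p - f (act g x)) := by
      simp only [mul_sub, Finset.sum_sub_distrib]
      congr 1
      · rw [hF]
        simp only [hpg, Finset.mul_sum]
        rw [Finset.sum_comm]
        simp only [S, Finset.sum_filter]
        refine Finset.sum_congr rfl fun m _ => ?_
        have : ∑ g, chr χ g * (eval x (monomial m (coeff m p)) * chr (dg m) g) =
            eval x (monomial m (coeff m p)) * ∑ g, chr χ g * chr (dg m) g := by
          rw [Finset.mul_sum]
          exact Finset.sum_congr rfl fun g _ => by ring
        rw [this, sum_chr]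
        split_ifs <;> simp [mul_comm, hc]
      · have : ∀ g : κ → ℤˣ, chr χ g * f (act g x) = f x := by
          intro g
          have h1 := abs_chr χ g
          rw [hχ x hx, ← mul_assoc, ← abs_mul_abs_self, h1]; simp
        simp only [this]
        simp [hc]
    have h2 : c * |eval x F - f x| ≤ c * ε := by
      rw [← abs_of_pos hc0, ← abs_mul, abs_of_pos hc0, key]
      refine (Finset.abs_sum_le_sum_abs _ _).trans ?_
      refine (Finset.sum_le_sum (g := fun _ => ε) fun g _ => ?_).trans ?_
      · rw [abs_mul, abs_chr, one_mul]
        exact (hp _ (act_mem g hx)).le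
      · simp [hc]
    exact le_of_mul_le_mul_left h2 hc0

variable {I : Type} [Fintype I] [DecidableEq I]

lemma alg_BU (e : I → κ → ℕ) (hI : Fintype.card I = Fintype.card κ * d) (hIn : Nonempty I)
    (hodd : Odd (BC d e).card) (F : I → Rg κ d)
    (hF : ∀ i, IsWeightedHomogeneous (wt κ d) (F i) (e i)) (ε : ℝ) (hε : 0 < ε) :
    ∃ x ∈ KS κ d, ∀ i, |eval x (F i)| ≤ ε := by
  have hfin := alg_generic e hI hIn hodd (fun i => F i - Gf d e i)
    (fun i => Submodule.sub_mem (Sg κ d (e i)) (hF i) (Gf_hom e i))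
  have hbd : ∀ i, ∃ C, ∀ x ∈ KS κ d, ‖eval x (F i - Gf d e i)‖ ≤ C := fun i =>
    isCompact_KS.exists_bound_of_continuousOn (contDiff_eval _).continuous.continuousOn
  choose C hC using hbd
  let C' : ℝ := 1 + ∑ i, |C i|
  have hC' : 0 < C' := by
    have : 0 ≤ ∑ i, |C i| := Finset.sum_nonneg fun _ _ => abs_nonneg _
    simp only [C']; linarith
  have hinf : (Set.Ioo (1 - ε / C') 1).Infinite := Set.Ioo_infinite (by
    have : 0 < ε / C' := div_pos hε hC'
    linarith)
  obtain ⟨t, ht, htn⟩ := hinf.exists_notMem_finite hfin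
  simp only [Set.mem_ofPred_eq, not_not] at htn
  obtain ⟨x, hx, hx0⟩ := htn
  refine ⟨x, hx, fun i => ?_⟩
  have h1 := hx0 i
  have h2 : eval x (F i) = (1 - t) * eval x (F i - Gf d e i) := by
    simp only [map_add, map_sub, smul_eq_C_mul, map_mul, eval_C] at h1 ⊢
    linear_combination h1
  have h3 : |eval x (F i - Gf d e i)| ≤ C' := by
    have h4 := hC i x hx
    rw [Real.norm_eq_abs] at h4
    have h5 : |C i| ≤ ∑ i, |C i| :=
      Finset.single_le_sum (f := fun i => |C i|) (fun _ _ => abs_nonneg _) (Finset.mem_univ i)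
    have := le_abs_self (C i)
    simp only [C']; linarith
  rw [h2, abs_mul, abs_of_pos (by linarith [ht.2])]
  calc (1 - t) * |eval x (F i - Gf d e i)| ≤ ε / C' * C' := by
        apply mul_le_mul _ h3 (abs_nonneg _) (div_pos hε hC').le
        linarith [ht.1]
    _ = ε := div_mul_cancel₀ _ hC'.ne'

theorem cont_BU (hI : Fintype.card I = Fintype.card κ * d) (hIn : Nonempty I) (χ : I → κ → ℕ)
    (hodd : ∀ e : I → κ → ℕ, (∀ i j, e i j ≡ χ i j [MOD 2]) → Odd (BC d e).card)
    (f : I → (κ × Fin (d + 1) → ℝ) → ℝ) (hf : ∀ i, ContinuousOn (f i) (KS κ d))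
    (hχ : ∀ i, ∀ x ∈ KS κ d, ∀ g, f i (act g x) = chr (χ i) g * f i x) :
    ∃ x ∈ KS κ d, ∀ i, f i x = 0 := by
  have happ : ∀ ε : ℝ, 0 < ε → ∃ x ∈ KS κ d, ∀ i, |f i x| ≤ ε := by
    intro ε hε
    have := fun i => approx (f i) (hf i) (χ i) (hχ i) (ε / 2) (by linarith)
    choose e F he hF hFf using this
    obtain ⟨x, hx, hxF⟩ := alg_BU e hI hIn (hodd e he) F hF (ε / 2) (by linarith)
    refine ⟨x, hx, fun i => ?_⟩
    have h1 := hFf i x hx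
    have h2 := hxF i
    rw [abs_le] at *
    constructor <;> linarith
  have hne : (KS κ d).Nonempty := by
    obtain ⟨x, hx, _⟩ := happ 1 one_pos
    exact ⟨x, hx⟩
  have hcont : ContinuousOn (fun x => ∑ i, |f i x|) (KS κ d) :=
    continuousOn_finsetSum _ fun i _ => (hf i).abs
  obtain ⟨x, hx, hmin⟩ := isCompact_KS.exists_isMinOn hne hcont
  refine ⟨x, hx, fun i => ?_⟩
  have hle : ∀ ε : ℝ, 0 < ε → |f i x| ≤ 0 + ε := by
    intro ε hε
    have hcard : (0 : ℝ) < Fintype.card I := by exact_mod_cast Fintype.card_pos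
    obtain ⟨y, hy, hyf⟩ := happ (ε / Fintype.card I) (div_pos hε hcard)
    have h1 : ∑ i, |f i x| ≤ ∑ i, |f i y| := hmin hy
    have h2 : ∑ i, |f i y| ≤ ∑ _i : I, ε / Fintype.card I := Finset.sum_le_sum fun i _ => hyf i
    have h3 : |f i x| ≤ ∑ i, |f i x| :=
      Finset.single_le_sum (f := fun i => |f i x|) (fun _ _ => abs_nonneg _) (Finset.mem_univ i)
    have h4 : ∑ _i : I, ε / Fintype.card I = ε := by
      rw [Finset.sum_const, Finset.card_univ, nsmul_eq_mul]
      field_simp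
    linarith
  exact abs_nonpos_iff.1 (le_of_forall_pos_le_add hle)

end BU

end part_PG

section part_PH
open MvPolynomial Module

set_option linter.unusedSectionVars false
set_option linter.style.haveILetI false
namespace BU

lemma ident {R : Type*} [CommRing R] (a b c d : R) : ∃ ga gb gc gd : R,
    ((a - b) * (a - c) * (a - d) * (b - c) * (b - d) * (c - d)) *
      ((b + c + d) * (a + c + d) * (a + b + d) * (a + b + c) - a * b * c * d) =
      a ^ 5 * ga + b ^ 5 * gb + c ^ 5 * gc + d ^ 5 * gd := by
  refine ⟨
    ( a * b ^ 3 * c +  b ^ 4 * c +  b ^ 3 * c ^ 2 -  b ^ 2 * c ^ 3 -  a * b ^ 3 * d -  b ^ 4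
      * d -  b ^ 3 * d ^ 2 +  b ^ 2 * d ^ 3 +  a * b * d ^ 3 +  b * d ^ 4 -  a * b * c ^ 3 -
      b * c ^ 4 +  a * c ^ 3 * d +  c ^ 4 * d +  c ^ 3 * d ^ 2 -  c ^ 2 * d ^ 3 -  a * c * d ^
      3 -  c * d ^ 4),
    (- a ^ 4 * c -  a ^ 3 * c ^ 2 +  a ^ 4 * d +  a ^ 3 * d ^ 2 -  a ^ 3 * b * c +  a ^ 2 *
      c ^ 3 +  a ^ 3 * b * d -  a ^ 2 * d ^ 3 -  a * b * d ^ 3 -  a * d ^ 4 +  a * b * c ^ 3 +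
      a * c ^ 4 -  b * c ^ 3 * d -  c ^ 4 * d -  c ^ 3 * d ^ 2 +  c ^ 2 * d ^ 3 +  b * c * d ^
      3 +  c * d ^ 4),
    ( a ^ 4 * b +  a ^ 3 * b ^ 2 -  a ^ 4 * d -  a ^ 3 * d ^ 2 -  a ^ 2 * b ^ 3 +  a ^ 3 * b
      * c -  a ^ 3 * c * d +  a ^ 2 * d ^ 3 +  a * c * d ^ 3 +  a * d ^ 4 -  a * b ^ 4 -  a *
      b ^ 3 * c +  b ^ 4 * d +  b ^ 3 * d ^ 2 +  b ^ 3 * c * d -  b ^ 2 * d ^ 3 -  b * c * d ^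
      3 -  b * d ^ 4),
    (- a ^ 4 * b -  a ^ 3 * b ^ 2 +  a ^ 4 * c +  a ^ 3 * c ^ 2 +  a ^ 2 * b ^ 3 -  a ^ 3 *
      b * d -  a ^ 2 * c ^ 3 +  a ^ 3 * c * d -  a * c ^ 4 -  a * c ^ 3 * d +  a * b ^ 4 +  a
      * b ^ 3 * d -  b ^ 4 * c -  b ^ 3 * c ^ 2 +  b ^ 2 * c ^ 3 -  b ^ 3 * c * d +  b * c ^ 4
      +  b * c ^ 3 * d), ?_⟩
  ring

abbrev R4 := MvPolynomial (Fin 4) (ZMod 2)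

def J (k : ℕ) : Ideal R4 := Ideal.span (Set.range fun i : Fin 4 => (X i : R4) ^ k)

lemma mem_J {k : ℕ} {p : R4} : p ∈ J k ↔ ∀ m, coeff m p ≠ 0 → ∃ i, k ≤ m i := by
  have h : (Set.range fun i : Fin 4 => (X i : R4) ^ k) =
      (fun s => monomial s (1 : ZMod 2)) '' (Set.range fun i : Fin 4 => Finsupp.single i k) := by
    rw [← Set.range_comp]
    congr 1
    funext i
    simp [X_pow_eq_monomial]
  rw [J, h, mem_ideal_span_monomial_image]
  simp only [MvPolynomial.mem_support_iff, Set.exists_range_iff, Finsupp.single_le_iff]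

lemma J_anti {k l : ℕ} (h : l ≤ k) : J k ≤ J l := by
  intro p hp
  rw [mem_J] at *
  intro m hm
  obtain ⟨i, hi⟩ := hp m hm
  exact ⟨i, h.trans hi⟩

def e4 : R4 := X 0 * X 1 * X 2 * X 3
def ad : R4 := (X 0 + X 1) * (X 0 + X 2) * (X 0 + X 3) * (X 1 + X 2) * (X 1 + X 3) * (X 2 + X 3)
def E4 : R4 := (X 1 + X 2 + X 3) * (X 0 + X 2 + X 3) * (X 0 + X 1 + X 3) * (X 0 + X 1 + X 2)

def cst (n : ℕ) : Fin 4 →₀ ℕ := Finsupp.equivFunOnFinite.symm (fun _ => n)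

lemma e4_pow (n : ℕ) : e4 ^ n = monomial (cst n) 1 := by
  have : e4 = monomial (cst 1) 1 := by
    rw [monomial_eq, Finsupp.prod_fintype _ _ (by simp)]
    simp [e4, cst, Fin.prod_univ_four]
  have hc : n • cst 1 = cst n := by
    ext i
    simp [cst]
  rw [this, monomial_pow, one_pow, hc]

lemma e4_mul_mem {k n : ℕ} {p : R4} : e4 ^ n * p ∈ J (k + n) ↔ p ∈ J k := by
  rw [e4_pow, mem_J, mem_J]
  constructor
  · intro h m hm
    obtain ⟨i, hi⟩ := h (cst n + m) (by simpa [coeff_monomial_mul] using hm)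
    refine ⟨i, ?_⟩
    simp [cst] at hi
    omega
  · intro h m hm
    rw [coeff_monomial_mul'] at hm
    split_ifs at hm with hle
    · rw [one_mul] at hm
      obtain ⟨i, hi⟩ := h _ hm
      refine ⟨i, ?_⟩
      have := hle i
      simp [cst] at hi this
      omega
    · exact absurd rfl hm

lemma ad_frob (q : ℕ) : (ad * E4) ^ 2 ^ q - (e4 * ad) ^ 2 ^ q ∈ J (5 * 2 ^ q) := by
  obtain ⟨ga, gb, gc, gd, h⟩ := ident (X 0 : R4) (X 1) (X 2) (X 3)
  have h1 : ad * E4 - e4 * ad = X 0 ^ 5 * ga + X 1 ^ 5 * gb + X 2 ^ 5 * gc + X 3 ^ 5 * gd := by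
    rw [← h]
    simp only [CharTwo.sub_eq_add, ad, E4, e4]
    ring
  rw [← sub_pow_char_pow, h1, add_pow_char_pow, add_pow_char_pow, add_pow_char_pow]
  simp only [mul_pow, ← pow_mul]
  have hX : ∀ i : Fin 4, (X i : R4) ^ (5 * 2 ^ q) ∈ J (5 * 2 ^ q) := fun i =>
    Ideal.subset_span ⟨i, rfl⟩
  exact add_mem (add_mem (add_mem (Ideal.mul_mem_right _ _ (hX 0)) (Ideal.mul_mem_right _ _ (hX 1)))
    (Ideal.mul_mem_right _ _ (hX 2))) (Ideal.mul_mem_right _ _ (hX 3))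

lemma stepi (q s t : ℕ) (ht : 1 ≤ t) (hst : s + t = 2 ^ q)
    (h : (e4 * ad * E4) ^ (2 ^ q + s) ∈ J (5 * 2 ^ q + 2 * s + 1)) :
    e4 ^ (t - 1) * (ad ^ (2 ^ q + s) * E4 ^ s) ∈ J (4 * 2 ^ q) := by
  set N := 2 ^ q with hN
  have h1 : e4 ^ (N + s) * ((ad * E4) ^ N - (e4 * ad) ^ N) ∈ J (5 * N + 2 * s + 1) :=
    J_anti (by omega) (e4_mul_mem (k := 5 * N) (n := N + s) |>.2 (ad_frob q))
  have h2 : e4 ^ (2 * N + s) * (ad ^ (N + s) * E4 ^ s) ∈ J (5 * N + 2 * s + 1) := by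
    have h3 := sub_mem h (Ideal.mul_mem_right ((ad * E4) ^ s) _ h1)
    convert h3 using 1
    ring
  have h4 : 5 * N + 2 * s + 1 = (3 * N + s + 1) + (2 * N + s) := by ring
  rw [h4, e4_mul_mem] at h2
  have h5 : 4 * N = (3 * N + s + 1) + (t - 1) := by omega
  rw [h5, e4_mul_mem]
  exact h2

end BU

end part_PH

section part_PH2
open MvPolynomial Module

set_option linter.unusedSectionVars false
set_option linter.style.haveILetI false
namespace BU

/-- the ideal generated by `X ^ n` and the extension of an ideal of coefficients -/
def extI {A : Type*} [CommRing A] (a : Ideal A) (n : ℕ) : Ideal (Polynomial A) :=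
  Ideal.span {Polynomial.X ^ n} ⊔ a.map Polynomial.C

lemma coeff_mem_of_extI {A : Type*} [CommRing A] {a : Ideal A} {n : ℕ} {p : Polynomial A}
    (hp : p ∈ extI a n) {k : ℕ} (hk : k < n) : p.coeff k ∈ a := by
  rw [extI, Submodule.mem_sup] at hp
  obtain ⟨y, hy, z, hz, rfl⟩ := hp
  rw [Ideal.mem_span_singleton'] at hy
  obtain ⟨u, rfl⟩ := hy
  rw [Ideal.mem_map_C_iff] at hz
  rw [Polynomial.coeff_add, Polynomial.coeff_mul_X_pow', if_neg (by omega), zero_add]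
  exact hz k

lemma C_mem_extI {A : Type*} [CommRing A] {a : Ideal A} {n : ℕ} {r : A} (h : r ∈ a) :
    Polynomial.C r ∈ extI a n :=
  Ideal.mem_sup_right (Ideal.mem_map_of_mem _ h)

lemma X_mem_extI {A : Type*} [CommRing A] {a : Ideal A} {n : ℕ} :
    (Polynomial.X : Polynomial A) ^ n ∈ extI a n :=
  Ideal.mem_sup_left (Ideal.subset_span rfl)

section genA
variable {A : Type*} [CommRing A] [CharP A 2] [Algebra (ZMod 2) A] (vc vb va : A)

def phi : R4 →ₐ[ZMod 2] Polynomial A :=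
  aeval ![Polynomial.X + Polynomial.C vc, Polynomial.X + Polynomial.C vb,
    Polynomial.X + Polynomial.C va, Polynomial.X + Polynomial.C 0]

lemma phi0 : phi vc vb va (X 0) = Polynomial.X + Polynomial.C vc := by simp [phi]
lemma phi1 : phi vc vb va (X 1) = Polynomial.X + Polynomial.C vb := by simp [phi]
lemma phi2 : phi vc vb va (X 2) = Polynomial.X + Polynomial.C va := by simp [phi]
lemma phi3 : phi vc vb va (X 3) = Polynomial.X + Polynomial.C 0 := by simp [phi]

lemma lin_mem (I : Ideal A) (q : ℕ) (r : A) (hr : r ^ 2 ^ q ∈ I) :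
    ((Polynomial.X + Polynomial.C r : Polynomial A)) ^ 2 ^ q ∈ extI I (2 ^ q) := by
  rw [add_pow_char_pow, ← Polynomial.C_pow]
  exact add_mem X_mem_extI (C_mem_extI hr)

lemma phi_mem (I : Ideal A) (q : ℕ) (hc : vc ^ 2 ^ q ∈ I) (hb : vb ^ 2 ^ q ∈ I)
    (ha : va ^ 2 ^ q ∈ I) {p : R4} (hp : p ∈ J (2 ^ q)) :
    phi vc vb va p ∈ extI I (2 ^ q) := by
  have : J (2 ^ q) ≤ (extI I (2 ^ q)).comap (phi vc vb va) := by
    rw [J, Ideal.span_le]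
    rintro _ ⟨i, rfl⟩
    simp only [SetLike.mem_coe, Ideal.mem_comap, map_pow]
    fin_cases i
    · exact phi0 vc vb va ▸ lin_mem I q _ hc
    · exact phi1 vc vb va ▸ lin_mem I q _ hb
    · exact phi2 vc vb va ▸ lin_mem I q _ ha
    · refine phi3 vc vb va ▸ lin_mem I q _ ?_
      rw [zero_pow (by positivity)]
      exact zero_mem _
  exact this hp

lemma phi_ad : phi vc vb va ad =
    Polynomial.C (va * vb * vc * (va + vb) * (va + vc) * (vb + vc)) := by
  have h2 : (Polynomial.X : Polynomial A) + Polynomial.X = 0 := CharTwo.add_self_eq_zero _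
  have key : ∀ r r' : A,
      (Polynomial.X + Polynomial.C r + (Polynomial.X + Polynomial.C r') : Polynomial A)
      = Polynomial.C (r + r') := by
    intro r r'
    rw [Polynomial.C_add]
    linear_combination h2
  simp only [ad, map_mul, map_add, phi0, phi1, phi2, phi3]
  simp only [← Polynomial.C_add, key]
  simp only [← Polynomial.C_mul]
  congr 1
  ring

lemma monic_prod4 (hA : Nontrivial A) (r1 r2 r3 r4 : A) :
    ((Polynomial.X + Polynomial.C r1) * (Polynomial.X + Polynomial.C r2) *
      (Polynomial.X + Polynomial.C r3) * (Polynomial.X + Polynomial.C r4) : Polynomial A).Monic ∧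
    ((Polynomial.X + Polynomial.C r1) * (Polynomial.X + Polynomial.C r2) *
      (Polynomial.X + Polynomial.C r3) *
      (Polynomial.X + Polynomial.C r4) : Polynomial A).natDegree = 4 := by
  have h := fun r : A => Polynomial.monic_X_add_C r
  refine ⟨(((h r1).mul (h r2)).mul (h r3)).mul (h r4), ?_⟩
  rw [(((h r1).mul (h r2)).mul (h r3)).natDegree_mul (h r4),
    ((h r1).mul (h r2)).natDegree_mul (h r3), (h r1).natDegree_mul (h r2)]
  simp only [Polynomial.natDegree_X_add_C]

lemma phi_e4 (hA : Nontrivial A) : (phi vc vb va e4).Monic ∧ (phi vc vb va e4).natDegree = 4 := by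
  simp only [e4, map_mul, phi0, phi1, phi2, phi3]
  exact monic_prod4 hA _ _ _ _

lemma phi_E4 (hA : Nontrivial A) : (phi vc vb va E4).Monic ∧ (phi vc vb va E4).natDegree = 4 := by
  have h2 : (Polynomial.X : Polynomial A) + Polynomial.X = 0 := CharTwo.add_self_eq_zero _
  have key : ∀ r r' r'' : A, (Polynomial.X + Polynomial.C r + (Polynomial.X + Polynomial.C r') +
      (Polynomial.X + Polynomial.C r'') : Polynomial A)
      = Polynomial.X + Polynomial.C (r + r' + r'') := by
    intro r r' r''
    rw [Polynomial.C_add, Polynomial.C_add]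
    linear_combination h2
  simp only [E4, map_mul, map_add, phi0, phi1, phi2, phi3]
  simp only [key]
  exact monic_prod4 hA _ _ _ _

lemma stepii (hA : Nontrivial A) (q u s M : ℕ) (hus : u + s + 1 = 2 ^ q) (I : Ideal A)
    (hc : vc ^ (4 * 2 ^ q) ∈ I) (hb : vb ^ (4 * 2 ^ q) ∈ I) (ha : va ^ (4 * 2 ^ q) ∈ I)
    (h : e4 ^ u * (ad ^ M * E4 ^ s) ∈ J (4 * 2 ^ q)) :
    (va * vb * vc * (va + vb) * (va + vc) * (vb + vc)) ^ M ∈ I := by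
  have h4 : 4 * 2 ^ q = 2 ^ (q + 2) := by ring
  rw [h4] at h hc hb ha
  have h1 := phi_mem _ _ _ I _ hc hb ha h
  rw [← h4] at h1
  have he := phi_e4 vc vb va hA
  have hE := phi_E4 vc vb va hA
  have hm : ((phi vc vb va e4) ^ u * (phi vc vb va E4) ^ s).Monic := (he.1.pow u).mul (hE.1.pow s)
  have hdeg : ((phi vc vb va e4) ^ u * (phi vc vb va E4) ^ s).natDegree = 4 * (u + s) := by
    rw [(he.1.pow u).natDegree_mul (hE.1.pow s), he.1.natDegree_pow,
      hE.1.natDegree_pow, he.2, hE.2]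
    ring
  have h2 : phi vc vb va (e4 ^ u * (ad ^ M * E4 ^ s)) =
      Polynomial.C ((va * vb * vc * (va + vb) * (va + vc) * (vb + vc)) ^ M) *
        ((phi vc vb va e4) ^ u * (phi vc vb va E4) ^ s) := by
    rw [map_mul, map_mul, map_pow, map_pow, map_pow, phi_ad, Polynomial.C_pow]
    ring
  rw [h2] at h1
  have h3 := coeff_mem_of_extI h1 (k := 4 * (u + s)) (by omega)
  rw [Polynomial.coeff_C_mul, ← hdeg, hm.coeff_natDegree, mul_one] at h3
  exact h3

end genA

lemma choose_odd (q : ℕ) : ∀ M, 2 ^ q ≤ M → M < 2 ^ (q + 1) → ((M.choose (2 ^ q) : ℕ) : ZMod 2) = 1 := by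
  induction q with
  | zero =>
    intro M h1 h2
    have : M = 1 := by simp at h1 h2; omega
    subst this
    simp
  | succ q ih =>
    intro M h1 h2
    have h3 := @Choose.choose_modEq_choose_mod_mul_choose_div_nat M (2 ^ (q + 1)) 2 _
    have h4 := (ZMod.natCast_eq_natCast_iff _ _ _).2 h3
    have e1 : 2 ^ (q + 1) % 2 = 0 := by rw [pow_succ]; omega
    have e2 : 2 ^ (q + 1) / 2 = 2 ^ q := by rw [pow_succ]; omega
    rw [h4, e1, e2, Nat.choose_zero_right, one_mul]
    rw [pow_succ] at h1 h2
    exact ih _ (by omega) (by omega)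

lemma step3a {A : Type*} [CommRing A] (B K : A) (I : Ideal A) (N s : ℕ) (hs : s < N)
    (h : ((Polynomial.X : Polynomial A) * Polynomial.C B * Polynomial.C K *
      (Polynomial.X + Polynomial.C B) * (Polynomial.X + Polynomial.C K) *
      (Polynomial.C B + Polynomial.C K)) ^ (N + s) ∈ extI I (4 * N)) :
    (B * K * (B + K)) ^ (N + s) * ∑ x ∈ Finset.HasAntidiagonal.antidiagonal (2 * N),
      (B ^ (N + s - x.1) * ((N + s).choose x.1 : A)) *
      (K ^ (N + s - x.2) * ((N + s).choose x.2 : A)) ∈ I := by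
  have h1 : ((Polynomial.X : Polynomial A) * Polynomial.C B * Polynomial.C K *
      (Polynomial.X + Polynomial.C B) * (Polynomial.X + Polynomial.C K) *
      (Polynomial.C B + Polynomial.C K)) ^ (N + s) =
      Polynomial.C ((B * K * (B + K)) ^ (N + s)) * (((Polynomial.X + Polynomial.C B) ^ (N + s) *
        (Polynomial.X + Polynomial.C K) ^ (N + s)) * Polynomial.X ^ (N + s)) := by
    simp only [Polynomial.C_pow, Polynomial.C_mul, Polynomial.C_add, ← mul_pow]
    congr 1
    ring
  rw [h1] at h
  have h2 := coeff_mem_of_extI h (k := 2 * N + (N + s)) (by omega)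
  rw [Polynomial.coeff_C_mul, Polynomial.coeff_mul_X_pow, Polynomial.coeff_mul] at h2
  simpa only [Polynomial.coeff_X_add_C_pow] using h2

lemma step3b {A : Type*} [CommRing A] (c : A) (I : Ideal A) (N s : ℕ) (hs : s < N)
    (h : ((Polynomial.X : Polynomial A) * Polynomial.C c *
        (Polynomial.X + Polynomial.C c)) ^ (N + s) * ∑ x ∈ Finset.HasAntidiagonal.antidiagonal (2 * N),
      (Polynomial.X ^ (N + s - x.1) * ((N + s).choose x.1 : Polynomial A)) *
      (Polynomial.C c ^ (N + s - x.2) * ((N + s).choose x.2 : Polynomial A)) ∈ extI I (4 * N)) :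
    c ^ (N + 3 * s) * ((∑ x ∈ Finset.HasAntidiagonal.antidiagonal (2 * N),
      (N + s).choose x.1 * (N + s).choose x.1 * (N + s).choose x.2 : ℕ) : A) ∈ I := by
  have h3 := coeff_mem_of_extI h (k := 2 * (N + s)) (by omega)
  rw [Finset.mul_sum, Polynomial.finsetSum_coeff] at h3
  convert h3 using 1
  rw [Nat.cast_sum, Finset.mul_sum]
  refine Finset.sum_congr rfl fun x hx => ?_
  rw [Finset.HasAntidiagonal.mem_antidiagonal] at hx
  rcases lt_or_ge (N + s) x.1 with h1 | h1
  · simp [Nat.choose_eq_zero_of_lt h1]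
  rcases lt_or_ge (N + s) x.2 with h2 | h2
  · simp [Nat.choose_eq_zero_of_lt h2]
  obtain ⟨u, hu⟩ := Nat.exists_eq_add_of_le h1
  obtain ⟨v, hv⟩ := Nat.exists_eq_add_of_le h2
  have e : ((Polynomial.X : Polynomial A) * Polynomial.C c *
        (Polynomial.X + Polynomial.C c)) ^ (N + s) *
      ((Polynomial.X ^ (N + s - x.1) * ((N + s).choose x.1 : Polynomial A)) *
      (Polynomial.C c ^ (N + s - x.2) * ((N + s).choose x.2 : Polynomial A))) =
      Polynomial.C (c ^ (N + s) * ((N + s).choose x.1 : A) * c ^ (N + s - x.2) *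
        ((N + s).choose x.2 : A)) *
        ((Polynomial.X + Polynomial.C c) ^ (N + s) *
          Polynomial.X ^ ((N + s) + (N + s - x.1))) := by
    simp only [Polynomial.C_mul, Polynomial.C_pow, Polynomial.C_eq_natCast, mul_pow, pow_add]
    ring
  rw [e, Polynomial.coeff_C_mul]
  have e2 : 2 * (N + s) = x.1 + ((N + s) + (N + s - x.1)) := by omega
  rw [e2, Polynomial.coeff_mul_X_pow, Polynomial.coeff_X_add_C_pow]
  have e3 : N + 3 * s = (N + s) + (N + s - x.2) + (N + s - x.1) := by omega
  rw [e3]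
  push_cast
  ring

lemma sum_choose (q s : ℕ) (hs : s < 2 ^ q) :
    ((∑ x ∈ Finset.HasAntidiagonal.antidiagonal (2 * 2 ^ q), (2 ^ q + s).choose x.1 * (2 ^ q + s).choose x.1 *
      (2 ^ q + s).choose x.2 : ℕ) : ZMod 2) = 1 := by
  have hsq : ∀ z : ZMod 2, z * z = z := by decide
  push_cast
  simp only [hsq]
  have := choose_odd (q + 1) ((2 ^ q + s) + (2 ^ q + s)) (by rw [pow_succ]; omega)
    (by rw [pow_succ, pow_succ]; omega)
  rw [pow_succ, mul_comm (2 ^ q) 2, Nat.add_choose_eq] at this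
  push_cast at this
  exact this

abbrev T0 := Polynomial (ZMod 2)
abbrev T1 := Polynomial T0
abbrev T2 := Polynomial T1

lemma step_final (q s u : ℕ) (hs : u + s + 1 = 2 ^ q)
    (h : e4 ^ u * (ad ^ (2 ^ q + s) * E4 ^ s) ∈ J (4 * 2 ^ q)) : False := by
  have hs' : s < 2 ^ q := by omega
  set n := 4 * 2 ^ q with hn
  let i0 : Ideal T0 := Ideal.span {Polynomial.X ^ n}
  let i1 : Ideal T1 := extI i0 n
  let i2 : Ideal T2 := extI i1 n
  have h1 := stepii (A := T2) (Polynomial.C (Polynomial.C Polynomial.X)) (Polynomial.C Polynomial.X)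
    Polynomial.X inferInstance q u s (2 ^ q + s) hs i2
    (by
      rw [← Polynomial.C_pow, ← Polynomial.C_pow]
      exact C_mem_extI (C_mem_extI (Ideal.subset_span rfl)))
    (by
      rw [← Polynomial.C_pow]
      exact C_mem_extI X_mem_extI)
    X_mem_extI h
  have h2 := step3a _ _ i1 _ s hs' h1
  have h3 := step3b _ i0 _ s hs' h2
  rw [← Polynomial.C_eq_natCast, sum_choose q s hs', Polynomial.C_1, mul_one] at h3
  rw [Ideal.mem_span_singleton, Polynomial.X_pow_dvd_iff] at h3
  have h4 := h3 (2 ^ q + 3 * s) (by omega)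
  rw [Polynomial.coeff_X_pow, if_pos rfl] at h4
  exact one_ne_zero h4

theorem coeff_exists (q s t : ℕ) (ht : 1 ≤ t) (hst : s + t = 2 ^ q) :
    ∃ γ : Fin 4 →₀ ℕ, (∀ i, γ i ≤ 5 * 2 ^ q + 2 * s) ∧
      coeff γ ((e4 * ad * E4) ^ (2 ^ q + s)) ≠ 0 := by
  by_contra hcon
  push Not at hcon
  refine step_final q s (t - 1) (by omega) (stepi q s t ht hst ?_)
  rw [mem_J]
  intro m hm
  by_contra h
  push Not at h
  exact hm (hcon m fun i => by have := h i; omega)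

end BU

end part_PH2

section part_PH3
open MvPolynomial Module

set_option linter.unusedSectionVars false
set_option linter.style.haveILetI false
namespace BU

section gen
variable {κ : Type} [Fintype κ] [DecidableEq κ] {d : ℕ} {I : Type} [Fintype I] [DecidableEq I]

lemma card_BC (d : ℕ) (e : I → κ → ℕ) : (((BC d e).card : ℕ) : ZMod 2) =
    coeff (Finsupp.equivFunOnFinite.symm (fun _ : κ => d))
      (∏ i, ∑ j, C ((e i j : ℕ) : ZMod 2) * (X j : MvPolynomial κ (ZMod 2))) := by
  classical
  have h1 : ∀ i, ∑ j, C ((e i j : ℕ) : ZMod 2) * (X j : MvPolynomial κ (ZMod 2)) =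
      ∑ p ∈ Tset e i, X p.1 := by
    intro i
    rw [Tset, Finset.sum_sigma]
    simp
  have h2 : ∀ c : I → Tt κ, (∏ i, (X (c i).1 : MvPolynomial κ (ZMod 2))) =
      monomial (Finsupp.equivFunOnFinite.symm (cnt c)) 1 := by
    intro c
    rw [monomial_eq, Finsupp.prod_fintype _ _ (by simp), C_1, one_mul]
    simp only [Finsupp.equivFunOnFinite_symm_apply_apply, cnt]
    rw [← Finset.prod_fiberwise (s := Finset.univ) (g := fun i => (c i).1)]
    refine Finset.prod_congr rfl fun j _ => ?_
    rw [Finset.prod_congr rfl (g := fun _ => X j), Finset.prod_const]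
    intro i hi
    rw [(Finset.mem_filter.1 hi).2]
  simp only [h1, Finset.prod_univ_sum, h2, coeff_sum, coeff_monomial]
  rw [Finset.sum_boole, BC]
  congr 3
  ext c
  simp only [bal]
  rw [Equiv.apply_eq_iff_eq, funext_iff]

lemma odd_BC (d : ℕ) (χ : I → κ → ℕ) (h : coeff (Finsupp.equivFunOnFinite.symm (fun _ : κ => d))
      (∏ i, ∑ j, C ((χ i j : ℕ) : ZMod 2) * (X j : MvPolynomial κ (ZMod 2))) ≠ 0)
    (e : I → κ → ℕ) (he : ∀ i j, e i j ≡ χ i j [MOD 2]) : Odd (BC d e).card := by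
  rw [← ZMod.natCast_ne_zero_iff_odd, card_BC]
  have : ∀ i j, ((e i j : ℕ) : ZMod 2) = ((χ i j : ℕ) : ZMod 2) := fun i j =>
    (ZMod.natCast_eq_natCast_iff _ _ _).2 (he i j)
  simpa only [this] using h

end gen

abbrev S14 := {S : Finset (Fin 4) // S.Nonempty ∧ S ≠ Finset.univ}

lemma card_S14 : Fintype.card S14 = 14 := by decide

lemma prod_S14 : (∏ S : S14, ∑ j ∈ S.1, (X j : R4)) = e4 * ad * E4 := by
  have hF : ∀ S : Finset (Fin 4), S ∈ ({{0}, {1}, {2}, {3}, {0, 1}, {0, 2}, {0, 3}, {1, 2}, {1, 3},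
      {2, 3}, {1, 2, 3}, {0, 2, 3}, {0, 1, 3}, {0, 1, 2}} : Finset (Finset (Fin 4))) ↔
      (S.Nonempty ∧ S ≠ Finset.univ) := by decide
  rw [← Finset.prod_subtype _ hF (fun S => ∑ j ∈ S, (X j : R4))]
  repeat rw [Finset.prod_insert (by decide)]
  rw [Finset.prod_singleton]
  have p2 : ∀ i j : Fin 4, i ≠ j → ∑ l ∈ ({i, j} : Finset (Fin 4)), (X l : R4) = X i + X j :=
    fun i j h => Finset.sum_pair h
  have p3 : ∀ i j k : Fin 4, i ∉ ({j, k} : Finset (Fin 4)) → j ≠ k →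
      ∑ l ∈ ({i, j, k} : Finset (Fin 4)), (X l : R4) = X i + X j + X k :=
    fun i j k h h' => by rw [Finset.sum_insert h, p2 _ _ h', add_assoc]
  rw [p3 1 2 3 (by decide) (by decide), p3 0 2 3 (by decide) (by decide),
    p3 0 1 3 (by decide) (by decide), p3 0 1 2 (by decide) (by decide)]
  repeat rw [p2 _ _ (by decide)]
  simp only [Finset.sum_singleton, e4, ad, E4]
  ring

abbrev Idx (m d : ℕ) (γ : Fin 4 → ℕ) := (Fin m × S14) ⊕ (Σ j : Fin 4, Fin (d - γ j))

def chi (m d : ℕ) (γ : Fin 4 → ℕ) : Idx m d γ → Fin 4 → ℕ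
  | Sum.inl p => fun j => if j ∈ p.2.1 then 1 else 0
  | Sum.inr p => fun j => if j = p.1 then 1 else 0

theorem comb (q s t : ℕ) (ht : 1 ≤ t) (hst : s + t = 2 ^ q) (m d : ℕ) (hm : m = 2 ^ q + s)
    (hd : d = 5 * 2 ^ q + 2 * s) : ∃ γ : Fin 4 → ℕ,
    Fintype.card (Idx m d γ) = Fintype.card (Fin 4) * d ∧
    ∀ e : Idx m d γ → Fin 4 → ℕ, (∀ i j, e i j ≡ chi m d γ i j [MOD 2]) → Odd (BC d e).card := by
  obtain ⟨γ, hγ, hc⟩ := coeff_exists q s t ht hst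
  rw [← hm, ← prod_S14] at hc
  rw [← hd] at hγ
  refine ⟨γ, ?_, odd_BC d _ ?_⟩
  · have hh : ((∏ S : S14, ∑ j ∈ S.1, (X j : R4)) ^ m).IsHomogeneous (14 * m) := by
      have h1 : (∏ S : S14, ∑ j ∈ S.1, (X j : R4)).IsHomogeneous (∑ S : S14, 1) :=
        IsHomogeneous.prod _ _ _ fun S _ => IsHomogeneous.sum _ _ _ fun j _ => isHomogeneous_X _ _
      have h2 : (∑ S : S14, 1) = 14 := by
        rw [Finset.sum_const, Finset.card_univ, card_S14]; rfl
      rw [h2] at h1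
      exact h1.pow m
    have h3 : γ.degree = 14 * m := by
      by_contra hne
      exact hc (hh.coeff_eq_zero hne)
    rw [Finsupp.degree_eq_sum, Fin.sum_univ_four] at h3
    simp only [Fintype.card_sum, Fintype.card_prod, Fintype.card_fin, card_S14, Fintype.card_sigma,
      Fin.sum_univ_four]
    have := hγ 0
    have := hγ 1
    have := hγ 2
    have := hγ 3
    omega
  · have hl : ∀ p : Fin m × S14, ∑ j, C ((chi m d γ (Sum.inl p) j : ℕ) : ZMod 2) * (X j : R4) =
        ∑ j ∈ p.2.1, X j := by
      intro p
      simp [chi, Finset.sum_ite_mem]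
    have hr : ∀ p : (Σ j : Fin 4, Fin (d - γ j)),
        ∑ j, C ((chi m d γ (Sum.inr p) j : ℕ) : ZMod 2) * (X j : R4) = X p.1 := by
      intro p
      simp [chi]
    have hr2 : ∏ j : Fin 4, ∏ _l : Fin (d - γ j), (X j : R4) =
        monomial (Finsupp.equivFunOnFinite.symm (fun j => d - γ j)) 1 := by
      rw [monomial_eq, Finsupp.prod_fintype _ _ (by simp), C_1, one_mul]
      simp
    rw [Fintype.prod_sum_type]
    simp only [hl, hr]
    rw [Fintype.prod_prod_type, Fintype.prod_sigma, hr2]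
    simp only [Finset.prod_const, Finset.card_univ, Fintype.card_fin]
    have hs : (Finsupp.equivFunOnFinite.symm (fun _ : Fin 4 => d)) =
        γ + Finsupp.equivFunOnFinite.symm (fun j => d - γ j) := by
      ext j
      have := hγ j
      simp
      omega
    rw [hs, coeff_mul_monomial, mul_one]
    exact hc

end BU

end part_PH3

section part_PI
set_option linter.unusedSectionVars false
set_option linter.style.haveILetI false
namespace BU

variable {d : ℕ}

def nrm (x : Fin 4 × Fin (d + 1) → ℝ) (j : Fin 4) : EuclideanSpace ℝ (Fin d) :=
  WithLp.toLp 2 (fun i => x (j, i.castSucc))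

def lin (x : Fin 4 × Fin (d + 1) → ℝ) (j : Fin 4) (y : EuclideanSpace ℝ (Fin d)) : ℝ :=
  ⟪nrm x j, y⟫ + x (j, Fin.last d)

lemma lin_eq (x : Fin 4 × Fin (d + 1) → ℝ) (j : Fin 4) (y : EuclideanSpace ℝ (Fin d)) :
    lin x j y = ∑ i : Fin d, x (j, i.castSucc) * y i + x (j, Fin.last d) := by
  simp [lin, nrm, PiLp.inner_apply, mul_comm]

lemma lin_cont_x (j : Fin 4) (y : EuclideanSpace ℝ (Fin d)) : Continuous (fun x => lin x j y) := by
  simp only [lin_eq]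
  fun_prop

lemma lin_cont_y (x : Fin 4 × Fin (d + 1) → ℝ) (j : Fin 4) : Continuous (lin x j) := by
  unfold lin
  fun_prop

lemma lin_act (g : Fin 4 → ℤˣ) (x : Fin 4 × Fin (d + 1) → ℝ) (j : Fin 4)
    (y : EuclideanSpace ℝ (Fin d)) : lin (act g x) j y = ((g j : ℤ) : ℝ) * lin x j y := by
  simp only [lin_eq, act]
  rw [mul_add, Finset.mul_sum]
  congr 1
  · exact Finset.sum_congr rfl fun i _ => by ring
  · ring

lemma sign_unit (g : ℤˣ) (u : ℝ) : Real.sign (((g : ℤ) : ℝ) * u) = ((g : ℤ) : ℝ) * Real.sign u := by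
  rcases Int.units_eq_one_or g with rfl | rfl
  · simp
  · simp [Real.sign_neg]

lemma meas_sign : Measurable Real.sign := by
  unfold Real.sign
  exact Measurable.ite measurableSet_Iio measurable_const
    (Measurable.ite measurableSet_Ioi measurable_const measurable_const)

lemma abs_sign_le (u : ℝ) : |Real.sign u| ≤ 1 := by
  rcases Real.sign_apply_eq u with h | h | h <;> rw [h] <;> simp

lemma cont_sign {u : ℝ} (hu : u ≠ 0) : ContinuousAt Real.sign u := by
  rcases lt_or_gt_of_ne hu with h | h
  · refine (continuousAt_const (y := (-1 : ℝ))).congr ?_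
    filter_upwards [Iio_mem_nhds h] with v hv
    exact (Real.sign_of_neg hv).symm
  · refine (continuousAt_const (y := (1 : ℝ))).congr ?_
    filter_upwards [Ioi_mem_nhds h] with v hv
    exact (Real.sign_of_pos hv).symm

lemma hyper_null (a : EuclideanSpace ℝ (Fin d)) (b : ℝ) (h : ¬ (a = 0 ∧ b = 0)) :
    volume {y : EuclideanSpace ℝ (Fin d) | ⟪a, y⟫ + b = 0} = 0 := by
  let s : AffineSubspace ℝ (EuclideanSpace ℝ (Fin d)) :=
    { carrier := {y | ⟪a, y⟫ + b = 0}
      smul_vsub_vadd_mem' := by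
        intro c p1 p2 p3 h1 h2 h3
        simp only [Set.mem_ofPred_eq] at *
        simp only [vsub_eq_sub, vadd_eq_add, inner_add_right, inner_smul_right, inner_sub_right]
        linear_combination c * h1 - c * h2 + h3 }
  refine Measure.addHaar_affineSubspace volume s ?_
  intro hs
  have hmem : ∀ y, ⟪a, y⟫ + b = 0 := by
    intro y
    have : y ∈ s := by rw [hs]; trivial
    exact this
  have h0 := hmem 0
  have h1 := hmem a
  rw [inner_zero_right, zero_add] at h0
  rw [h0, add_zero, inner_self_eq_zero] at h1
  exact h ⟨h1, h0⟩

lemma KS_ne {x : Fin 4 × Fin (d + 1) → ℝ} (hx : x ∈ KS (Fin 4) d) (j : Fin 4) :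
    ¬ (nrm x j = 0 ∧ x (j, Fin.last d) = 0) := by
  rintro ⟨h1, h2⟩
  have h3 : ∑ l, x (j, l) ^ 2 = 1 := hx j
  rw [Fin.sum_univ_castSucc, h2] at h3
  have h4 : ∀ i : Fin d, x (j, i.castSucc) = 0 := by
    intro i
    have := congrArg (fun v : EuclideanSpace ℝ (Fin d) => v i) h1
    simpa [nrm] using this
  simp [h4] at h3

lemma ae_ne {x : Fin 4 × Fin (d + 1) → ℝ} (hx : x ∈ KS (Fin 4) d)
    (μ : Measure (EuclideanSpace ℝ (Fin d))) (hac : μ ≪ volume) :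
    ∀ᵐ y ∂μ, ∀ j, lin x j y ≠ 0 := by
  rw [ae_all_iff]
  intro j
  rw [ae_iff]
  have := hac (hyper_null (nrm x j) (x (j, Fin.last d)) (KS_ne hx j))
  simpa [lin] using this

def fS (μ : Measure (EuclideanSpace ℝ (Fin d))) (S : Finset (Fin 4))
    (x : Fin 4 × Fin (d + 1) → ℝ) : ℝ := ∫ y, ∏ j ∈ S, Real.sign (lin x j y) ∂μ

lemma meas_prod (x : Fin 4 × Fin (d + 1) → ℝ) (S : Finset (Fin 4)) :
    Measurable (fun y => ∏ j ∈ S, Real.sign (lin x j y)) :=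
  Finset.measurable_fun_prod _ fun j _ => meas_sign.comp (lin_cont_y x j).measurable

lemma norm_prod_le (x : Fin 4 × Fin (d + 1) → ℝ) (S : Finset (Fin 4))
    (y : EuclideanSpace ℝ (Fin d)) : ‖∏ j ∈ S, Real.sign (lin x j y)‖ ≤ 1 := by
  rw [Real.norm_eq_abs, Finset.abs_prod]
  exact Finset.prod_le_one (fun _ _ => abs_nonneg _) fun _ _ => abs_sign_le _

lemma int_prod (μ : Measure (EuclideanSpace ℝ (Fin d))) [IsFiniteMeasure μ]
    (x : Fin 4 × Fin (d + 1) → ℝ) (S : Finset (Fin 4)) :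
    Integrable (fun y => ∏ j ∈ S, Real.sign (lin x j y)) μ :=
  Integrable.of_bound (meas_prod x S).aestronglyMeasurable 1
    (Filter.Eventually.of_forall (norm_prod_le x S))

lemma fS_cont (μ : Measure (EuclideanSpace ℝ (Fin d))) [IsFiniteMeasure μ] (hac : μ ≪ volume)
    (S : Finset (Fin 4)) : ContinuousOn (fS μ S) (KS (Fin 4) d) := by
  intro x hx
  refine continuousWithinAt_of_dominated (bound := fun _ => 1)
    (Filter.Eventually.of_forall fun x => (meas_prod x S).aestronglyMeasurable)
    (Filter.Eventually.of_forall fun x => Filter.Eventually.of_forall (norm_prod_le x S))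
    (integrable_const _) ?_
  filter_upwards [ae_ne hx μ hac] with y hy
  refine ContinuousAt.continuousWithinAt ?_
  refine tendsto_finsetProd _ fun j _ => ?_
  exact ContinuousAt.comp (f := fun x => lin x j y) (g := Real.sign) (cont_sign (hy j))
    (lin_cont_x j y).continuousAt

lemma fS_act (μ : Measure (EuclideanSpace ℝ (Fin d))) (S : Finset (Fin 4)) (g : Fin 4 → ℤˣ)
    (x : Fin 4 × Fin (d + 1) → ℝ) :
    fS μ S (act g x) = (∏ j ∈ S, ((g j : ℤ) : ℝ)) * fS μ S x := by
  simp only [fS, lin_act, sign_unit, Finset.prod_mul_distrib]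
  rw [integral_const_mul]

def sgb (b : Bool) : ℝ := if b then 1 else -1

lemma meas_region {k : ℕ} (a : Fin k → EuclideanSpace ℝ (Fin d)) (b : Fin k → ℝ)
    (s : Finset (Fin k)) (ε : Fin k → Bool) : MeasurableSet (region a b s ε) := by
  refine Finset.measurableSet_biInter _ fun i _ => ?_
  unfold halfSpace
  split_ifs
  · exact (isClosed_le continuous_const (by fun_prop)).measurableSet
  · exact (isClosed_le (by fun_prop) continuous_const).measurableSet

lemma ind_half (x : Fin 4 × Fin (d + 1) → ℝ) (j : Fin 4) (b : Bool)
    (y : EuclideanSpace ℝ (Fin d)) (hy : lin x j y ≠ 0) :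
    (1 + sgb b * Real.sign (lin x j y)) / 2 =
      (halfSpace (nrm x j) (-x (j, Fin.last d)) b).indicator (fun _ => (1 : ℝ)) y := by
  classical
  rw [Set.indicator_apply]
  have hm : y ∈ halfSpace (nrm x j) (-x (j, Fin.last d)) b ↔ if b then 0 < lin x j y else
      lin x j y < 0 := by
    unfold halfSpace
    rcases b with _ | _
    · simp only [Bool.false_eq_true, if_false, Set.mem_ofPred_eq]
      rw [lt_iff_le_and_ne]
      unfold lin at *
      exact ⟨fun h => ⟨by linarith, hy⟩, fun h => by linarith [h.1]⟩
    · simp only [if_true, Set.mem_ofPred_eq]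
      rw [lt_iff_le_and_ne]
      unfold lin at *
      exact ⟨fun h => ⟨by linarith, hy.symm⟩, fun h => by linarith [h.1]⟩
  simp only [hm]
  rcases lt_or_gt_of_ne hy with h | h
  · rw [Real.sign_of_neg h]
    rcases b with _ | _
    · simp [sgb, h]
    · simp [sgb, h.le]
  · rw [Real.sign_of_pos h]
    rcases b with _ | _
    · simp [sgb, h.le]
    · simp [sgb, h]

lemma region_measure (μ : Measure (EuclideanSpace ℝ (Fin d))) [IsFiniteMeasure μ]
    (hac : μ ≪ volume) {x : Fin 4 × Fin (d + 1) → ℝ} (hx : x ∈ KS (Fin 4) d)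
    (hz : ∀ S : Finset (Fin 4), S.Nonempty → S ≠ Finset.univ → fS μ S x = 0)
    (s : Finset (Fin 4)) (hs : s.card = 3) (ε : Fin 4 → Bool) :
    μ (region (nrm x) (fun j => -x (j, Fin.last d)) s ε) = μ Set.univ / 2 ^ 3 := by
  classical
  set R := region (nrm x) (fun j => -x (j, Fin.last d)) s ε with hR
  have h1 : ∫ y, R.indicator (fun _ => (1 : ℝ)) y ∂μ = μ.real R := by
    rw [integral_indicator (hR ▸ meas_region _ _ _ _)]
    simp
  have h2 : (fun y => R.indicator (fun _ => (1 : ℝ)) y) =ᵐ[μ]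
      fun y => (1 / 8) * ∑ T ∈ s.powerset, (∏ j ∈ T, sgb (ε j)) *
        ∏ j ∈ T, Real.sign (lin x j y) := by
    filter_upwards [ae_ne hx μ hac] with y hy
    have e1 : R.indicator (fun _ => (1 : ℝ)) y =
        ∏ j ∈ s, (1 + sgb (ε j) * Real.sign (lin x j y)) / 2 := by
      rw [Finset.prod_congr rfl fun j _ => ind_half x j (ε j) y (hy j)]
      simp only [Set.indicator_apply]
      rw [Finset.prod_ite_zero]
      simp [hR, region]
    rw [e1, Finset.prod_div_distrib, Finset.prod_const, hs, Finset.prod_one_add]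
    simp only [Finset.prod_mul_distrib]
    ring
  have h3 : μ.real R = (1 / 8) * μ.real Set.univ := by
    rw [← h1, integral_congr_ae h2, integral_const_mul, integral_finsetSum]
    · congr 1
      simp only [integral_const_mul]
      rw [Finset.sum_eq_single ∅]
      · simp
      · intro T hT hne
        have hT' := Finset.card_le_card (Finset.mem_powerset.1 hT)
        have := hz T (Finset.nonempty_iff_ne_empty.2 hne) (by
          rintro rfl
          rw [hs] at hT'
          simp at hT')
        rw [fS] at this
        rw [this, mul_zero]
      · intro h
        exact absurd (Finset.empty_mem_powerset s) h
    · intro T _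
      exact (int_prod μ x T).const_mul _
  have h4 : μ R ≠ ⊤ := measure_ne_top _ _
  have h5 : μ Set.univ / 2 ^ 3 ≠ ⊤ := ENNReal.div_ne_top (measure_ne_top _ _) (by simp)
  rw [← ENNReal.toReal_eq_toReal_iff' h4 h5]
  rw [ENNReal.toReal_div]
  unfold Measure.real at h3
  rw [h3]
  norm_num
  ring

lemma nrm_ne (μ : Measure (EuclideanSpace ℝ (Fin d))) [IsFiniteMeasure μ] (hμ : μ ≠ 0)
    {x : Fin 4 × Fin (d + 1) → ℝ} (hx : x ∈ KS (Fin 4) d) (j : Fin 4) (hz : fS μ {j} x = 0) :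
    nrm x j ≠ 0 := by
  intro h
  have hb : x (j, Fin.last d) ≠ 0 := fun h' => KS_ne hx j ⟨h, h'⟩
  simp only [fS, Finset.prod_singleton, lin, h, inner_zero_left, zero_add, integral_const,
    smul_eq_mul, mul_eq_zero] at hz
  rcases hz with hz | hz
  · rw [measureReal_eq_zero_iff, Measure.measure_univ_eq_zero] at hz
    exact hμ hz
  · exact hb (Real.sign_eq_zero_iff.1 hz)

theorem main (q s t : ℕ) (ht : 1 ≤ t) (hst : s + t = 2 ^ q) (m d : ℕ) (hm : m = 2 ^ q + s)
    (hd : d = 5 * 2 ^ q + 2 * s) (μ : Fin m → Measure (EuclideanSpace ℝ (Fin d)))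
    (hfin : ∀ r, IsFiniteMeasure (μ r)) (hac : ∀ r, μ r ≪ volume) :
    ∃ x ∈ KS (Fin 4) d, ∀ r, ∀ S : Finset (Fin 4), S.Nonempty → S ≠ Finset.univ →
      fS (μ r) S x = 0 := by
  obtain ⟨γ, hcard, hodd⟩ := comb q s t ht hst m d hm hd
  have hpos : 0 < 2 ^ q := by positivity
  have hIn : Nonempty (Idx m d γ) := ⟨Sum.inl (⟨0, by omega⟩, ⟨{0}, by decide⟩)⟩
  obtain ⟨x, hx, h⟩ := cont_BU hcard hIn (chi m d γ) hodd
    (fun i x => Sum.elim (fun p => fS (μ p.1) p.2.1 x) (fun p => x (p.1, 0)) i) (by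
      rintro (p | p)
      · have := hfin p.1
        exact fS_cont _ (hac _) _
      · exact (continuous_apply (p.1, (0 : Fin (d + 1)))).continuousOn) (by
      rintro (p | p) x _ g
      · simp only [Sum.elim_inl, fS_act]
        congr 1
        simp [chr, chi, Finset.prod_ite_mem]
      · simp only [Sum.elim_inr, act]
        rw [mul_comm]
        congr 1
        simp [chr, chi])
  exact ⟨x, hx, fun r S h1 h2 => h (Sum.inl (r, ⟨S, h1, h2⟩))⟩

end BU

end part_PI

theorem stmt_1 (q t : ℕ) (ht1 : 1 ≤ t) (ht2 : t ≤ 2 ^ q)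
    (m d : ℕ) (hm : m = 2 ^ (q + 1) - t) (hd : d = 7 * 2 ^ q - 2 * t)
    (μ : Fin m → Measure (EuclideanSpace ℝ (Fin d)))
    (hfin : ∀ r, IsFiniteMeasure (μ r))
    (hac : ∀ r, μ r ≪ volume) :
    ∃ (a : Fin 4 → EuclideanSpace ℝ (Fin d)) (b : Fin 4 → ℝ),
      (∀ i, a i ≠ 0) ∧
      ∀ r : Fin m, ∀ s : Finset (Fin 4), s.card = 3 → ∀ ε : Fin 4 → Bool,
        μ r (region a b s ε) = μ r Set.univ / 2 ^ 3 := by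
  have hpos : 0 < 2 ^ q := by positivity
  by_cases hall : ∀ r, μ r = 0
  · have hd0 : 0 < d := by omega
    refine ⟨fun _ => EuclideanSpace.single ⟨0, hd0⟩ 1, fun _ => 0, fun i => ?_, fun r s _ ε => ?_⟩
    · simp
    · simp [hall r]
  · push Not at hall
    obtain ⟨r0, hr0⟩ := hall
    obtain ⟨x, hx, hz⟩ := BU.main q (2 ^ q - t) t ht1 (by omega) m d
      (by rw [pow_succ] at hm; omega) (by omega) μ hfin hac
    refine ⟨BU.nrm x, fun j => -x (j, Fin.last d), fun j => ?_, fun r s hs ε => ?_⟩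
    · have := hfin r0
      exact BU.nrm_ne (μ r0) hr0 hx j (hz r0 {j} (by simp) (by revert j; decide))
    · have := hfin r
      exact BU.region_measure (μ r) (hac r) hx (hz r) s hs ε
end
end

section
/- Let m ≥ 1, 2 ≤ ℓ ≤ k and d ≥ 1 be integers such that k·d < m·(2^ℓ − 1)·(k − ℓ + 1). Then there exist m masses μ_1, …, μ_m on ℝ^d such that there is no collection of k hyperplanes in ℝ^d with the property that any ℓ of the k hyperplanes equipartition every μ_i. -/
open MeasureTheory RealInnerProductSpace

noncomputable section

open Filter Topology in
/-- Finitely many small balls around points of the moment curve: no hyperplane meets more than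
`d` of them. -/
theorem exists_balls (d : ℕ) (ι : Type) [Fintype ι] :
    ∃ (P : ι → EuclideanSpace ℝ (Fin d)) (ρ : ℝ), 0 < ρ ∧
      ∀ (a : EuclideanSpace ℝ (Fin d)) (b : ℝ), a ≠ 0 → ∀ S : Finset ι,
        (∀ j ∈ S, ∃ x ∈ Metric.ball (P j) ρ, ⟪a, x⟫ = b) → S.card ≤ d := by
  classical
  obtain ⟨t, ht⟩ : ∃ t : ι → ℝ, Function.Injective t :=
    ⟨fun i => ((Fintype.equivFin ι i : ℕ) : ℝ), fun i j hij => by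
      apply (Fintype.equivFin ι).injective
      apply Fin.ext
      exact Nat.cast_injective (R := ℝ) hij⟩
  let P : ι → EuclideanSpace ℝ (Fin d) := fun j => WithLp.toLp 2 (fun i => t j ^ (i.val + 1))
  have key : ∀ S : Finset ι, ∀ᶠ ρ : ℝ in 𝓝[>] 0, S.card = d + 1 →
      ∀ (a : EuclideanSpace ℝ (Fin d)) (b : ℝ),
        (∀ j ∈ S, |⟪a, P j⟫ - b| ≤ ρ * ‖a‖) → a = 0 := by
    intro S
    by_cases hS : S.card = d + 1
    swap
    · exact Eventually.of_forall fun _ h => absurd h hS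
    let f : (EuclideanSpace ℝ (Fin d) × ℝ) →ₗ[ℝ] (S → ℝ) :=
      { toFun := fun p j => ⟪p.1, P j⟫ - p.2
        map_add' := by
          intro p q
          ext j
          simp only [Prod.fst_add, Prod.snd_add, Pi.add_apply, inner_add_left]
          ring
        map_smul' := by
          intro c p
          ext j
          simp only [Prod.smul_fst, Prod.smul_snd, Pi.smul_apply, inner_smul_left, smul_eq_mul,
            RingHom.id_apply, conj_trivial]
          ring }
    have hf : LinearMap.ker f = ⊥ := by
      rw [LinearMap.ker_eq_bot']
      rintro ⟨a, b⟩ hab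
      have h0 : ∀ j ∈ S, ⟪a, P j⟫ - b = 0 := fun j hj => congrFun hab ⟨j, hj⟩
      let c : Fin (d + 1) → ℝ := Fin.cons (-b) (fun i => a i)
      have hc : c = 0 := by
        let e : Fin (d + 1) ≃ S := (S.equivFinOfCardEq hS).symm
        refine Matrix.eq_zero_of_forall_index_sum_pow_mul_eq_zero (f := fun i => t (e i)) ?_ ?_
        · intro i j hij
          exact e.injective (Subtype.ext (ht hij))
        · intro j
          have := h0 (e j) (e j).2
          rw [Fin.sum_univ_succ]
          simp only [c, Fin.cons_zero, Fin.cons_succ, Fin.val_zero, Fin.val_succ, pow_zero]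
          simp only [P, PiLp.inner_apply, RCLike.inner_apply, conj_trivial] at this
          linarith
      have hb : b = 0 := by
        have := congrFun hc 0
        simpa [c] using this
      have ha : a = 0 := by
        ext i
        have := congrFun hc i.succ
        simpa [c] using this
      simp [ha, hb]
    obtain ⟨K, K0, hK⟩ := f.exists_antilipschitzWith hf
    have hlim : ∀ᶠ ρ : ℝ in 𝓝[>] 0, (K : ℝ) * ρ < 1 := by
      have : Tendsto (fun ρ : ℝ => (K : ℝ) * ρ) (𝓝[>] 0) (𝓝 (K * 0)) :=
        ((continuous_const.mul continuous_id).tendsto 0).mono_left nhdsWithin_le_nhds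
      rw [mul_zero] at this
      exact this.eventually_lt_const one_pos
    filter_upwards [hlim, self_mem_nhdsWithin] with ρ hρ hρ0 _ a b hab
    have hρ0' : 0 < ρ := hρ0
    by_contra hane
    have hapos : 0 < ‖a‖ := norm_pos_iff.mpr hane
    have h1 : ‖(a, b)‖ ≤ K * ‖f (a, b)‖ := by
      have := hK.le_mul_dist (a, b) 0
      simpa only [map_zero, dist_zero_right] using this
    have h2 : ‖f (a, b)‖ ≤ ρ * ‖a‖ := by
      rw [pi_norm_le_iff_of_nonneg (by positivity)]
      intro j
      exact hab j j.2
    have h3 : ‖a‖ ≤ ‖(a, b)‖ := norm_fst_le (a, b)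
    have h4 : (K : ℝ) * ‖f (a, b)‖ ≤ K * (ρ * ‖a‖) := by gcongr
    nlinarith
  have hall := (eventually_all.mpr key).and (self_mem_nhdsWithin (a := (0 : ℝ)) (s := Set.Ioi 0))
  obtain ⟨ρ, hρ, hρ0⟩ := hall.exists
  refine ⟨P, ρ, hρ0, fun a b ha S hS => ?_⟩
  by_contra hcard
  obtain ⟨S', hS', hc⟩ := Finset.exists_subset_card_eq (show d + 1 ≤ S.card by omega)
  refine ha (hρ S' hc a b fun j hj => ?_)
  obtain ⟨x, hx, hxb⟩ := hS j (hS' hj)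
  rw [← hxb, ← inner_sub_right]
  refine (abs_real_inner_le_norm _ _).trans ?_
  rw [mul_comm]
  have : ‖P j - x‖ < ρ := by
    rw [← dist_eq_norm, dist_comm]
    exact hx
  gcongr

/-- A ball missed by a hyperplane lies in one of the two closed half-spaces. -/
theorem exists_side {d : ℕ} (a : EuclideanSpace ℝ (Fin d)) (b : ℝ) (p : EuclideanSpace ℝ (Fin d))
    (ρ : ℝ) (h : ¬ ∃ x ∈ Metric.ball p ρ, ⟪a, x⟫ = b) :
    ∃ ε : Bool, Metric.ball p ρ ⊆ halfSpace a b ε := by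
  by_contra hne
  push Not at hne
  obtain ⟨x, hx, hx'⟩ := Set.not_subset.mp (hne true)
  obtain ⟨y, hy, hy'⟩ := Set.not_subset.mp (hne false)
  simp only [halfSpace, if_true, Set.mem_ofPred_eq, not_le] at hx'
  simp only [halfSpace, Bool.false_eq_true, if_false, Set.mem_ofPred_eq, not_le] at hy'
  have hcont : ContinuousOn (fun z => ⟪a, z⟫) (Metric.ball p ρ) := by fun_prop
  obtain ⟨z, hz, hzb⟩ := (convex_ball p ρ).isPreconnected.intermediate_value hx hy hcont
    ⟨hx'.le, hy'.le⟩
  exact h ⟨z, hz, hzb⟩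

theorem stmt_4 (m ℓ k d : ℕ) (hm : 1 ≤ m) (hℓ : 2 ≤ ℓ) (hℓk : ℓ ≤ k) (hd : 1 ≤ d)
    (h : k * d < m * (2 ^ ℓ - 1) * (k - ℓ + 1)) :
    ∃ μ : Fin m → Measure (EuclideanSpace ℝ (Fin d)),
      (∀ r, IsFiniteMeasure (μ r)) ∧ (∀ r, μ r ≪ volume) ∧
      ¬ ∃ (a : Fin k → EuclideanSpace ℝ (Fin d)) (b : Fin k → ℝ),
          (∀ i, a i ≠ 0) ∧
          ∀ r : Fin m, ∀ s : Finset (Fin k), s.card = ℓ → ∀ ε : Fin k → Bool,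
            μ r (region a b s ε) = μ r Set.univ / 2 ^ ℓ := by
  classical
  obtain ⟨P, ρ, hρ, hP⟩ := exists_balls d (Fin m × Fin (2 ^ ℓ - 1))
  have hN : 1 ≤ 2 ^ ℓ := Nat.one_le_two_pow
  let c : ENNReal := volume (Metric.ball (0 : EuclideanSpace ℝ (Fin d)) ρ)
  have hc : ∀ p, volume (Metric.ball (P p) ρ) = c := fun p =>
    Measure.addHaar_ball_center volume (P p) ρ
  have hc0 : c ≠ 0 := (Metric.measure_ball_pos volume _ hρ).ne'
  have hct : c ≠ ⊤ := measure_ball_lt_top.ne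
  refine ⟨fun r => ∑ j, volume.restrict (Metric.ball (P (r, j)) ρ), ?_, ?_, ?_⟩
  · intro r
    refine ⟨?_⟩
    simp only [Measure.finsetSum_apply, Measure.restrict_apply_univ, hc]
    simp only [Finset.sum_const, nsmul_eq_mul]
    exact ENNReal.mul_lt_top (ENNReal.natCast_lt_top _) hct.lt_top
  · intro r s hs
    simp only [Measure.finsetSum_apply]
    exact Finset.sum_eq_zero fun j _ => Measure.restrict_le_self.absolutelyContinuous hs
  rintro ⟨a, b, ha, hab⟩
  let hit : Fin k → Fin m × Fin (2 ^ ℓ - 1) → Prop :=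
    fun i p => ∃ x ∈ Metric.ball (P p) ρ, ⟪a i, x⟫ = b i
  -- each hyperplane meets at most `d` balls
  have h1 : ∀ i, (Finset.univ.filter fun p => hit i p).card ≤ d := fun i =>
    hP (a i) (b i) (ha i) _ fun j hj => (Finset.mem_filter.mp hj).2
  -- each ball is met by at least `k - ℓ + 1` hyperplanes
  have h2 : ∀ p, k - ℓ + 1 ≤ (Finset.univ.filter fun i => hit i p).card := by
    intro p
    by_contra hlt
    have hsum := Finset.card_filter_add_card_filter_not (s := (Finset.univ : Finset (Fin k)))
      (fun i => hit i p)
    rw [Finset.card_univ, Fintype.card_fin] at hsum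
    obtain ⟨s, hs, hcard⟩ := Finset.exists_subset_card_eq
      (show ℓ ≤ (Finset.univ.filter fun i => ¬ hit i p).card by omega)
    have hside : ∀ i, ∃ ε : Bool, i ∈ s → Metric.ball (P p) ρ ⊆ halfSpace (a i) (b i) ε := by
      intro i
      by_cases hi : i ∈ s
      · obtain ⟨ε, hε⟩ := exists_side (a i) (b i) (P p) ρ (Finset.mem_filter.mp (hs hi)).2
        exact ⟨ε, fun _ => hε⟩
      · exact ⟨true, fun h => absurd h hi⟩
    choose ε hε using hside
    have hsub : Metric.ball (P p) ρ ⊆ region a b s ε := Set.subset_iInter₂ hε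
    have heq := hab p.1 s hcard ε
    simp only [Measure.finsetSum_apply, Measure.restrict_apply_univ, hc] at heq
    simp only [Finset.sum_const, nsmul_eq_mul, Finset.card_univ, Fintype.card_fin] at heq
    have hge : c ≤ ∑ j, volume.restrict (Metric.ball (P (p.1, j)) ρ) (region a b s ε) := by
      refine le_trans ?_ (Finset.single_le_sum
        (f := fun j => volume.restrict (Metric.ball (P (p.1, j)) ρ) (region a b s ε))
        (fun _ _ => zero_le) (Finset.mem_univ p.2))
      rw [← hc p, ← Measure.restrict_apply_self volume (Metric.ball (P p) ρ)]
      exact measure_mono hsub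
    rw [heq, ENNReal.le_div_iff_mul_le (by simp) (by simp), mul_comm] at hge
    rw [ENNReal.mul_le_mul_iff_left hc0 hct] at hge
    have : 2 ^ ℓ ≤ 2 ^ ℓ - 1 := by exact_mod_cast hge
    omega
  have h3 : ∑ i, (Finset.univ.filter fun p => hit i p).card
      = ∑ p, (Finset.univ.filter fun i => hit i p).card :=
    Finset.sum_card_bipartiteAbove_eq_sum_card_bipartiteBelow hit
  have h4 : ∑ i, (Finset.univ.filter fun p => hit i p).card ≤ k * d := by
    refine (Finset.sum_le_sum fun i _ => h1 i).trans ?_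
    simp
  have h5 : m * (2 ^ ℓ - 1) * (k - ℓ + 1) ≤ ∑ p, (Finset.univ.filter fun i => hit i p).card := by
    refine le_trans ?_ (Finset.sum_le_sum fun p _ => h2 p)
    simp
  omega
end
end
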